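/- There exists an absolute constant C > 0 with the following property. Let u be a smooth global solution of the defocusing quintic nonlinear wave equation with E(u(t)) ≤ E for all t ∈ ℝ, satisfying the a priori bounds with constant A. Then for every s ≥ 0 and every t' ≥ s, the Duhamel integral satisfies ‖ D_{[0,s]}u ‖_{L⁴_{t,x}([t', ∞)×ℝ³)} ≤ C E^{1/4} A^{1/2}. -/

import Mathlib

open MeasureTheory Real Set Function
open scoped ENNReal NNReal FourierTransform

noncomputable section

/-- Three-dimensional Euclidean space `ℝ³`. -/
abbrev E3 : Type := EuclideanSpace ℝ (Fin 3)

/-- The time derivative `∂ₜ u` of a function `u : ℝ × ℝ³ → ℝ` (curried). -/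
def tderiv (u : ℝ → E3 → ℝ) (t : ℝ) (x : E3) : ℝ := deriv (fun s => u s x) t

/-- The second time derivative `∂ₜ² u`. -/
def tderiv2 (u : ℝ → E3 → ℝ) (t : ℝ) (x : E3) : ℝ := deriv (fun s => tderiv u s x) t

/-- The spatial Laplacian `Δ f = ∑ᵢ ∂ᵢ² f` of `f : ℝ³ → ℝ`. -/
def lap (f : E3 → ℝ) (x : E3) : ℝ :=
  ∑ i : Fin 3, iteratedFDeriv ℝ 2 f x ![EuclideanSpace.single i 1, EuclideanSpace.single i 1]

/-- `f : ℝ³ → ℝ` is a Schwartz function: it is smooth and all of its derivatives decay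
faster than any polynomial. -/
def IsSchwartz (f : E3 → ℝ) : Prop :=
  ContDiff ℝ (⊤ : ℕ∞) f ∧ ∀ k n : ℕ, ∃ C : ℝ, ∀ x, ‖x‖ ^ k * ‖iteratedFDeriv ℝ n f x‖ ≤ C

/-- `u` is a smooth solution of the defocusing quintic nonlinear wave equation
`∂ₜ²u − Δu + u⁵ = 0` on the time interval `I`, Schwartz in the space variable at each time. -/
def IsNLWOn (u : ℝ → E3 → ℝ) (I : Set ℝ) : Prop :=
  ContDiffOn ℝ (⊤ : ℕ∞) (uncurry u) (I ×ˢ univ) ∧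
  (∀ t ∈ I, IsSchwartz (u t) ∧ IsSchwartz (tderiv u t)) ∧
  (∀ t ∈ I, ∀ x, tderiv2 u t x - lap (u t) x + (u t x) ^ 5 = 0)

/-- `u` is a smooth global solution of the defocusing quintic nonlinear wave equation. -/
def IsNLW (u : ℝ → E3 → ℝ) : Prop := IsNLWOn u univ

/-- The energy `E(u(t)) = ∫ (1/2)|∂ₜu|² + (1/2)|∇ₓu|² + (1/6)u⁶ dx`. -/
def energy (u : ℝ → E3 → ℝ) (t : ℝ) : ℝ :=
  ∫ x : E3, ((1/2) * (tderiv u t x) ^ 2 + (1/2) * ‖gradient (u t) x‖ ^ 2 + (1/6) * (u t x) ^ 6)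

/-- The spatial `L^q` norm (`q` finite), valued in `ℝ≥0∞`. -/
def xNorm {F : Type*} [NormedAddCommGroup F] (q : ℝ) (f : E3 → F) : ℝ≥0∞ :=
  (∫⁻ x : E3, (‖f x‖₊ : ℝ≥0∞) ^ q) ^ (1/q)

/-- The mixed norm `‖u‖_{L^p_t L^q_x (I × ℝ³)}` for finite `p, q`. -/
def mixNorm (p q : ℝ) (I : Set ℝ) (u : ℝ → E3 → ℝ) : ℝ≥0∞ :=
  (∫⁻ t in I, (xNorm q (u t)) ^ p) ^ (1/p)

/-- The mixed norm `‖u‖_{L^∞_t L^q_x (I × ℝ³)}` (essential supremum in time). -/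
def supNorm (q : ℝ) (I : Set ℝ) (u : ℝ → E3 → ℝ) : ℝ≥0∞ :=
  essSup (fun t => xNorm q (u t)) (volume.restrict I)

/-- The homogeneous Sobolev norm `‖f‖_{Ḣ^s} = (∫ |ξ|^{2s} |𝓕f(ξ)|² dξ)^{1/2}`. -/
def sobNorm (s : ℝ) (f : E3 → ℝ) : ℝ≥0∞ :=
  (∫⁻ ξ : E3, (‖ξ‖₊ : ℝ≥0∞) ^ (2*s) *
    (‖𝓕 (fun x => (f x : ℂ)) ξ‖₊ : ℝ≥0∞) ^ (2:ℝ)) ^ ((1:ℝ)/2)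

/-- The a priori bounds with constant `A`:
`‖u(t)‖_{L²} ≤ A`, `‖∂ₜu(t)‖_{Ḣ⁻¹} ≤ A`, `‖u(t)‖_{Ḣ²} ≤ A`, `‖∂ₜu(t)‖_{Ḣ¹} ≤ A` for all `t`. -/
def APriori (u : ℝ → E3 → ℝ) (A : ℝ) : Prop :=
  ∀ t : ℝ, xNorm 2 (u t) ≤ ENNReal.ofReal A ∧ sobNorm (-1) (tderiv u t) ≤ ENNReal.ofReal A ∧
    sobNorm 2 (u t) ≤ ENNReal.ofReal A ∧ sobNorm 1 (tderiv u t) ≤ ENNReal.ofReal A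

/-- The integral of `f` over the sphere of radius `r` about `x`, with respect to
two-dimensional Hausdorff (surface) measure. -/
def sphInt (x : E3) (r : ℝ) (f : E3 → ℝ) : ℝ := ∫ y in Metric.sphere x r, f y ∂(μH[2])

/-- The free wave evolution `S(t)(g, h)` given by Kirchhoff's formula. -/
def freeWave (g h : E3 → ℝ) (t : ℝ) (x : E3) : ℝ :=
  if t = 0 then g x
  else deriv (fun s => (1/(4*π*s)) * sphInt x s g) t + (1/(4*π*t)) * sphInt x t h

/-- The Duhamel integral `D_{[s₁,s₂]}u(t,x) = ∫_{s₁}^{s₂} S(t−τ)(0, u(τ)⁵) dτ`,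
written via Kirchhoff's formula. -/
def duh (u : ℝ → E3 → ℝ) (s₁ s₂ : ℝ) (t : ℝ) (x : E3) : ℝ :=
  ∫ τ in s₁..s₂, (1/(4*π*(t - τ))) * sphInt x (t - τ) (fun y => (u τ y) ^ 5)


/-- Integration over `ℝ³` in Cartesian coordinates, the last two grouped. -/
lemma lintegral_E3_eq (f : E3 → ℝ≥0∞) (hf : Measurable f) :
    ∫⁻ ξ, f ξ = ∫⁻ x : ℝ, ∫⁻ p : ℝ × ℝ, f !₂[x, p.1, p.2] := by
  have e1 : MeasurePreserving (fun p : ℝ × (ℝ × ℝ) => (!₂[p.1, p.2.1, p.2.2] : E3)) := by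
    have h1 := ((volume_preserving_piFinSuccAbove (fun _ : Fin 3 => ℝ) 0).symm _)
    have h2 := ((volume_preserving_finTwoArrow ℝ).symm _)
    have h3 := (MeasurePreserving.id (volume : Measure ℝ)).prod h2
    have h4 := (PiLp.volume_preserving_toLp (Fin 3)).comp (h1.comp h3)
    convert h4 using 1
    · funext p
      ext i
      fin_cases i <;> simp [MeasurableEquiv.piFinSuccAbove, MeasurableEquiv.finTwoArrow,
        Fin.insertNthEquiv]
    · rfl
  rw [← e1.lintegral_comp hf, Measure.volume_eq_prod ℝ (ℝ × ℝ)]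
  exact lintegral_prod _ (hf.comp e1.measurable).aemeasurable

/-- Change of variables from the distance to the axis to the sum of the focal distances. -/
lemma setLIntegral_focal_le (x R : ℝ) (q : ℝ → ℝ≥0∞) :
    ∫⁻ ρ in Ioi (0 : ℝ), ENNReal.ofReal (ρ * ((√(x ^ 2 + ρ ^ 2))⁻¹ * (√((R - x) ^ 2 + ρ ^ 2))⁻¹)) *
        q (√(x ^ 2 + ρ ^ 2) + √((R - x) ^ 2 + ρ ^ 2)) ≤
      ∫⁻ τ in {τ | 0 < τ ∧ |x| + |R - x| ≤ τ}, ENNReal.ofReal τ⁻¹ * q τ := by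
  set F : ℝ → ℝ := fun ρ => √(x ^ 2 + ρ ^ 2) + √((R - x) ^ 2 + ρ ^ 2) with hF
  set F' : ℝ → ℝ := fun ρ => ρ / √(x ^ 2 + ρ ^ 2) + ρ / √((R - x) ^ 2 + ρ ^ 2) with hF'
  have hd1 : ∀ (a : ℝ) (ρ : ℝ), 0 < ρ →
      HasDerivAt (fun ρ => √(a ^ 2 + ρ ^ 2)) (ρ / √(a ^ 2 + ρ ^ 2)) ρ := by
    intro a ρ hρ
    have h0 : HasDerivAt (fun ρ : ℝ => a ^ 2 + ρ ^ 2) (2 * ρ) ρ := by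
      simpa using (hasDerivAt_pow 2 ρ).const_add (a ^ 2)
    convert h0.sqrt (by positivity) using 1
    field_simp
  have hd : ∀ ρ ∈ Ioi (0 : ℝ), HasDerivWithinAt F (F' ρ) (Ioi 0) ρ := fun ρ hρ =>
    ((hd1 x ρ hρ).add (hd1 (R - x) ρ hρ)).hasDerivWithinAt
  have hinj : InjOn F (Ioi 0) := by
    apply StrictMonoOn.injOn
    intro a ha b hb hab
    have ha' : (0 : ℝ) < a := ha
    have : a ^ 2 < b ^ 2 := by nlinarith
    exact add_lt_add (Real.sqrt_lt_sqrt (by positivity) (by linarith))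
      (Real.sqrt_lt_sqrt (by positivity) (by linarith))
  have hcv := lintegral_image_eq_lintegral_abs_deriv_mul measurableSet_Ioi hd hinj
    (fun τ => ENNReal.ofReal τ⁻¹ * q τ)
  have hsub : F '' Ioi 0 ⊆ {τ | 0 < τ ∧ |x| + |R - x| ≤ τ} := by
    rintro _ ⟨ρ, hρ, rfl⟩
    have hρ' : (0 : ℝ) < ρ := hρ
    refine ⟨by simp only [hF]; positivity, add_le_add ?_ ?_⟩
    · exact Real.abs_le_sqrt (by nlinarith)
    · exact Real.abs_le_sqrt (by nlinarith)
  refine le_trans (le_of_eq ?_) (hcv.symm.le.trans (lintegral_mono_set hsub))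
  refine setLIntegral_congr_fun measurableSet_Ioi fun ρ hρ => ?_
  have hρ' : (0 : ℝ) < ρ := hρ
  rw [← mul_assoc (ENNReal.ofReal |F' ρ|), ← ENNReal.ofReal_mul (abs_nonneg _)]
  congr 2
  have h1 : 0 < √(x ^ 2 + ρ ^ 2) := by positivity
  have h2 : 0 < √((R - x) ^ 2 + ρ ^ 2) := by positivity
  rw [abs_of_nonneg (by simp only [hF']; positivity)]
  simp only [hF, hF']
  field_simp
  ring

lemma lintegral_focal_axis_le (R : ℝ) (q : ℝ → ℝ≥0∞) (hq : Measurable q) :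
    ∫⁻ ξ : E3, ‖ξ‖ₑ⁻¹ * ‖(!₂[R, 0, 0] : E3) - ξ‖ₑ⁻¹ * q (‖ξ‖ + ‖(!₂[R, 0, 0] : E3) - ξ‖) ≤
      ENNReal.ofReal (2 * π) * ∫⁻ τ, q τ := by
  have hm : Measurable fun ξ : E3 =>
      ‖ξ‖ₑ⁻¹ * ‖(!₂[R, 0, 0] : E3) - ξ‖ₑ⁻¹ * q (‖ξ‖ + ‖(!₂[R, 0, 0] : E3) - ξ‖) := by
    fun_prop
  rw [lintegral_E3_eq _ hm]
  have key : ∀ x : ℝ, ∫⁻ p : ℝ × ℝ, ‖(!₂[x, p.1, p.2] : E3)‖ₑ⁻¹ *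
      ‖(!₂[R, 0, 0] : E3) - !₂[x, p.1, p.2]‖ₑ⁻¹ *
        q (‖(!₂[x, p.1, p.2] : E3)‖ + ‖(!₂[R, 0, 0] : E3) - !₂[x, p.1, p.2]‖) ≤
      ENNReal.ofReal (2 * π) *
        ∫⁻ τ in {τ | 0 < τ ∧ |x| + |R - x| ≤ τ}, ENNReal.ofReal τ⁻¹ * q τ := by
    intro x
    rw [← lintegral_comp_polarCoord_symm, polarCoord_target]
    have h1 : ∀ p : ℝ × ℝ, p ∈ Ioi (0 : ℝ) ×ˢ Ioo (-π) π →
        ENNReal.ofReal p.1 • (‖(!₂[x, (polarCoord.symm p).1, (polarCoord.symm p).2] : E3)‖ₑ⁻¹ *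
      ‖(!₂[R, 0, 0] : E3) - !₂[x, (polarCoord.symm p).1, (polarCoord.symm p).2]‖ₑ⁻¹ *
        q (‖(!₂[x, (polarCoord.symm p).1, (polarCoord.symm p).2] : E3)‖ +
          ‖(!₂[R, 0, 0] : E3) - !₂[x, (polarCoord.symm p).1, (polarCoord.symm p).2]‖)) =
        (ENNReal.ofReal (p.1 * ((√(x ^ 2 + p.1 ^ 2))⁻¹ * (√((R - x) ^ 2 + p.1 ^ 2))⁻¹)) *
        q (√(x ^ 2 + p.1 ^ 2) + √((R - x) ^ 2 + p.1 ^ 2))) * 1 := by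
      rintro ⟨ρ, θ⟩ ⟨hρ, -⟩
      have hρ' : (0 : ℝ) < ρ := hρ
      have hcs := Real.cos_sq_add_sin_sq θ
      have n1 : ‖(!₂[x, (polarCoord.symm (ρ, θ)).1, (polarCoord.symm (ρ, θ)).2] : E3)‖ =
          √(x ^ 2 + ρ ^ 2) := by
        rw [EuclideanSpace.norm_eq]
        congr 1
        simp [Fin.sum_univ_three, polarCoord]
        linear_combination ρ ^ 2 * hcs
      have n2 : ‖(!₂[R, 0, 0] : E3) -
          !₂[x, (polarCoord.symm (ρ, θ)).1, (polarCoord.symm (ρ, θ)).2]‖ =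
          √((R - x) ^ 2 + ρ ^ 2) := by
        rw [EuclideanSpace.norm_eq]
        congr 1
        simp [Fin.sum_univ_three, polarCoord]
        linear_combination ρ ^ 2 * hcs
      have p1 : 0 < √(x ^ 2 + ρ ^ 2) := by positivity
      have p2 : 0 < √((R - x) ^ 2 + ρ ^ 2) := by positivity
      rw [← ofReal_norm, ← ofReal_norm, n1, n2, ← ENNReal.ofReal_inv_of_pos p1,
        ← ENNReal.ofReal_inv_of_pos p2, ← ENNReal.ofReal_mul (by positivity), smul_eq_mul,
        ← mul_assoc, ← ENNReal.ofReal_mul hρ'.le, mul_one]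
    rw [setLIntegral_congr_fun (measurableSet_Ioi.prod measurableSet_Ioo) h1,
      Measure.volume_eq_prod ℝ ℝ, ← Measure.prod_restrict]
    rw [lintegral_prod_mul (f := fun r : ℝ =>
        ENNReal.ofReal (r * ((√(x ^ 2 + r ^ 2))⁻¹ * (√((R - x) ^ 2 + r ^ 2))⁻¹)) *
        q (√(x ^ 2 + r ^ 2) + √((R - x) ^ 2 + r ^ 2))) (g := fun _ => 1)
        (by fun_prop) aemeasurable_const]
    rw [mul_comm]
    refine mul_le_mul' (le_of_eq ?_) (setLIntegral_focal_le x R q)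
    simp [← two_mul]
  refine (lintegral_mono key).trans ?_
  rw [lintegral_const_mul' _ _ ENNReal.ofReal_ne_top]
  refine mul_le_mul_right ?_ _
  have hS : MeasurableSet {p : ℝ × ℝ | 0 < p.2 ∧ |p.1| + |R - p.1| ≤ p.2} :=
    (measurableSet_lt measurable_const measurable_snd).inter
      (measurableSet_le (by fun_prop) measurable_snd)
  have hSx : ∀ x : ℝ, MeasurableSet {τ : ℝ | 0 < τ ∧ |x| + |R - x| ≤ τ} := fun x =>
    measurable_prodMk_left hS
  calc ∫⁻ x : ℝ, ∫⁻ τ in {τ | 0 < τ ∧ |x| + |R - x| ≤ τ}, ENNReal.ofReal τ⁻¹ * q τ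
      = ∫⁻ x : ℝ, ∫⁻ τ : ℝ, {p : ℝ × ℝ | 0 < p.2 ∧ |p.1| + |R - p.1| ≤ p.2}.indicator
          (fun p => ENNReal.ofReal p.2⁻¹ * q p.2) (x, τ) := by
        refine lintegral_congr fun x => ?_
        rw [← lintegral_indicator (hSx x)]
        rfl
    _ = ∫⁻ τ : ℝ, ∫⁻ x : ℝ, {p : ℝ × ℝ | 0 < p.2 ∧ |p.1| + |R - p.1| ≤ p.2}.indicator
          (fun p => ENNReal.ofReal p.2⁻¹ * q p.2) (x, τ) := by
        refine lintegral_lintegral_swap (Measurable.aemeasurable ?_)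
        exact Measurable.indicator (by fun_prop) hS
    _ ≤ ∫⁻ τ, q τ := by
        refine lintegral_mono fun τ => ?_
        by_cases hτ : 0 < τ
        · have hle : ∀ x : ℝ, {p : ℝ × ℝ | 0 < p.2 ∧ |p.1| + |R - p.1| ≤ p.2}.indicator
              (fun p => ENNReal.ofReal p.2⁻¹ * q p.2) (x, τ) ≤
              (Icc ((R - τ) / 2) ((R + τ) / 2)).indicator
                (fun _ => ENNReal.ofReal τ⁻¹ * q τ) x := by
            intro x
            by_cases hx : 0 < τ ∧ |x| + |R - x| ≤ τ
            · rw [indicator_of_mem (by exact hx), indicator_of_mem]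
              have a1 := neg_abs_le x
              have a2 := le_abs_self x
              have a3 := neg_abs_le (R - x)
              have a4 := le_abs_self (R - x)
              constructor <;> linarith [hx.2]
            · rw [indicator_of_notMem (by exact hx)]
              exact zero_le
          refine (lintegral_mono hle).trans ?_
          rw [lintegral_indicator measurableSet_Icc, setLIntegral_const, Real.volume_Icc,
            mul_right_comm, ← ENNReal.ofReal_mul (by positivity)]
          have : τ⁻¹ * ((R + τ) / 2 - (R - τ) / 2) = 1 := by field_simp; ring
          rw [this]
          simp
        · have : ∀ x : ℝ, {p : ℝ × ℝ | 0 < p.2 ∧ |p.1| + |R - p.1| ≤ p.2}.indicator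
              (fun p => ENNReal.ofReal p.2⁻¹ * q p.2) (x, τ) = 0 := fun x =>
            indicator_of_notMem (fun h => hτ h.1) _
          simp [this]

/-- The convolution of the measures `dξ/|ξ|` on two copies of the light cone is bounded. -/
lemma lintegral_focal_le (z : E3) (q : ℝ → ℝ≥0∞) (hq : Measurable q) :
    ∫⁻ ξ : E3, ‖ξ‖ₑ⁻¹ * ‖z - ξ‖ₑ⁻¹ * q (‖ξ‖ + ‖z - ξ‖) ≤
      ENNReal.ofReal (2 * π) * ∫⁻ τ, q τ := by
  set e : E3 := !₂[‖z‖, 0, 0] with he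
  have hn : ‖e‖ = ‖z‖ := by
    rw [EuclideanSpace.norm_eq]
    simp [he, Fin.sum_univ_three]
  set L : E3 ≃ₗᵢ[ℝ] E3 := Submodule.reflection (Submodule.span ℝ {e - z})ᗮ with hL
  have hLe : L e = z := Submodule.reflection_sub hn
  rw [← L.measurePreserving.lintegral_comp (by fun_prop)]
  refine le_trans (le_of_eq ?_) (lintegral_focal_axis_le ‖z‖ q hq)
  refine lintegral_congr fun ξ => ?_
  have h1 : ‖L ξ‖ = ‖ξ‖ := L.norm_map ξ
  have h2 : ‖z - L ξ‖ = ‖e - ξ‖ := by rw [← hLe, ← map_sub, L.norm_map]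
  rw [← ofReal_norm, ← ofReal_norm (z - L ξ), h1, h2, ofReal_norm,
    ofReal_norm]

lemma norm_fourierChar (θ : ℝ) : ‖(𝐞 θ : ℂ)‖ = 1 := Circle.norm_coe _

section Gaussian

variable {V : Type*} [NormedAddCommGroup V] [InnerProductSpace ℝ V]

/-- The Gaussian of mass one and variance proportional to `ε`. -/
def gaussKer (ε : ℝ) (w : V) : ℝ :=
  (1 / ε) ^ (Module.finrank ℝ V / 2 : ℝ) * rexp (-(π / ε) * ‖w‖ ^ 2)

lemma gaussKer_nonneg {ε : ℝ} (hε : 0 < ε) (w : V) : 0 ≤ gaussKer ε w := by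
  unfold gaussKer; positivity

lemma gaussKer_neg (ε : ℝ) (w : V) : gaussKer ε (-w) = gaussKer ε w := by
  simp [gaussKer]

variable [MeasurableSpace V] [BorelSpace V]

lemma measurable_gaussKer (ε : ℝ) : Measurable (gaussKer ε : V → ℝ) := by
  unfold gaussKer; fun_prop

variable [FiniteDimensional ℝ V]

lemma integral_char_mul_gauss {ε : ℝ} (hε : 0 < ε) (w : V) :
    ∫ v : V, (𝐞 (inner ℝ v w) : ℂ) * (rexp (-(π * ε) * ‖v‖ ^ 2) : ℂ) = (gaussKer ε w : ℂ) := by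
  have hb : 0 < ((π * ε : ℝ) : ℂ).re := by
    rw [Complex.ofReal_re]; positivity
  have h := GaussianFourier.integral_cexp_neg_mul_sq_norm_add hb (2 * π * Complex.I) w
  have hε' : (ε : ℂ) ≠ 0 := by exact_mod_cast hε.ne'
  have hπ' : (π : ℂ) ≠ 0 := by exact_mod_cast Real.pi_ne_zero
  calc _ = ∫ v : V, Complex.exp (-((π * ε : ℝ) : ℂ) * ‖v‖ ^ 2 +
          2 * π * Complex.I * (inner ℝ w v : ℝ)) := by
        refine integral_congr_ae (ae_of_all _ fun v => ?_)
        simp only [Real.fourierChar_apply, Complex.ofReal_exp, ← Complex.exp_add]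
        congr 1
        rw [real_inner_comm]
        push_cast
        ring
    _ = _ := by
        rw [h, gaussKer]
        push_cast
        rw [Complex.ofReal_cpow (by positivity)]
        congr 2
        · push_cast
          field_simp
        · push_cast
          ring
        · field_simp
          rw [Complex.I_sq]
          ring

lemma lintegral_gaussKer {ε : ℝ} (hε : 0 < ε) :
    ∫⁻ v : V, ENNReal.ofReal (gaussKer ε v) = 1 := by
  have h1 := GaussianFourier.integral_rexp_neg_mul_sq_norm (V := V) (b := π / ε) (by positivity)
  have h2 : ∫ v : V, gaussKer ε v = 1 := by
    unfold gaussKer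
    rw [integral_const_mul, h1, ← Real.mul_rpow (by positivity) (by positivity)]
    have : 1 / ε * (π / (π / ε)) = 1 := by field_simp
    rw [this, Real.one_rpow]
  rw [← ofReal_integral_eq_lintegral_ofReal _ (ae_of_all _ (gaussKer_nonneg hε)), h2]
  · simp
  · by_contra hc
    rw [integral_undef hc] at h2
    exact zero_ne_one h2

lemma integrable_gauss {c : ℝ} (hc : 0 < c) : Integrable fun v : V => rexp (-c * ‖v‖ ^ 2) := by
  by_contra h
  have h1 := GaussianFourier.integral_rexp_neg_mul_sq_norm (V := V) hc
  rw [integral_undef h] at h1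
  have : 0 < (π / c) ^ (Module.finrank ℝ V / 2 : ℝ) := by positivity
  exact this.ne h1

end Gaussian

section Oscillatory

variable {Ω : Type*} [MeasurableSpace Ω] {μ : Measure Ω}

/-- A superposition of space-time plane waves with frequencies `(T P, Z P)`. -/
def waveSum (μ : Measure Ω) (Z : Ω → E3) (T : Ω → ℝ) (b : Ω → ℂ) (t : ℝ) (x : E3) : ℂ :=
  ∫ P, (𝐞 (inner ℝ x (Z P) + t * T P) : ℂ) * b P ∂μ

lemma continuous_waveSum {Z : Ω → E3} {T : Ω → ℝ} (hZ : Measurable Z) (hT : Measurable T)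
    {b : Ω → ℂ} (hb : Integrable b μ) :
    Continuous fun y : ℝ × E3 => waveSum μ Z T b y.1 y.2 := by
  unfold waveSum
  refine continuous_of_dominated (bound := fun P => ‖b P‖) (fun y => ?_) (fun y => ?_) hb.norm ?_
  · refine AEStronglyMeasurable.mul ?_ hb.aestronglyMeasurable
    exact (Measurable.aestronglyMeasurable (by fun_prop))
  · exact ae_of_all _ fun P => by rw [norm_mul, norm_fourierChar, one_mul]
  · exact ae_of_all _ fun P => by fun_prop

lemma lintegral_waveSum_sq_gauss_le [SFinite μ] {Z : Ω → E3} {T : Ω → ℝ} (hZ : Measurable Z)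
    (hT : Measurable T) {b : Ω → ℂ} (hb : Integrable b μ) {ε : ℝ} (hε : 0 < ε) :
    ∫⁻ y : ℝ × E3, ‖waveSum μ Z T b y.1 y.2‖ₑ ^ 2 *
        ENNReal.ofReal (rexp (-(π * ε) * ‖y.1‖ ^ 2) * rexp (-(π * ε) * ‖y.2‖ ^ 2)) ≤
      ∫⁻ p : Ω × Ω, ‖b p.1‖ₑ * ‖b p.2‖ₑ * (ENNReal.ofReal (gaussKer ε (T p.1 - T p.2)) *
        ENNReal.ofReal (gaussKer ε (Z p.1 - Z p.2))) ∂(μ.prod μ) := by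
  have hπε : 0 < π * ε := by positivity
  set g : ℝ × E3 → ℝ := fun y => rexp (-(π * ε) * ‖y.1‖ ^ 2) * rexp (-(π * ε) * ‖y.2‖ ^ 2) with hg
  have hgi : Integrable g := (integrable_gauss (V := ℝ) hπε).mul_prod (integrable_gauss (V := E3) hπε)
  have hg0 : ∀ y, 0 ≤ g y := fun y => by simp only [hg]; positivity
  set W : ℝ × E3 → ℂ := fun y => waveSum μ Z T b y.1 y.2 with hW
  have hWc : Continuous W := continuous_waveSum hZ hT hb
  set ph : ℝ × E3 → Ω → ℂ := fun y P => (𝐞 (inner ℝ y.2 (Z P) + y.1 * T P) : ℂ) with hph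
  set β : Ω × Ω → ℂ := fun p => b p.1 * (starRingEnd ℂ) (b p.2) with hβ
  have hbc : Integrable (fun P => (starRingEnd ℂ) (b P)) μ :=
    (Complex.conjCLE.toContinuousLinearMap.integrable_comp hb)
  have hβi : Integrable β (μ.prod μ) := hb.mul_prod hbc
  have hWW : ∀ y, (‖W y‖ ^ 2 : ℂ) =
      ∫ p, (𝐞 (inner ℝ y.2 (Z p.1 - Z p.2) + y.1 * (T p.1 - T p.2)) : ℂ) * β p ∂(μ.prod μ) := by
    intro y
    rw [← Complex.mul_conj']
    have : (starRingEnd ℂ) (W y) = ∫ P, (starRingEnd ℂ) (ph y P * b P) ∂μ := integral_conj.symm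
    rw [this]
    change (∫ P, ph y P * b P ∂μ) * _ = _
    rw [← integral_prod_mul (fun P => ph y P * b P) (fun P => (starRingEnd ℂ) (ph y P * b P))]
    refine integral_congr_ae (ae_of_all _ fun p => ?_)
    simp only [hβ, hph, map_mul, ← Circle.coe_inv_eq_conj, ← AddChar.map_neg_eq_inv]
    rw [mul_mul_mul_comm, ← Circle.coe_mul, ← AddChar.map_add_eq_mul]
    congr 3
    rw [inner_sub_right]
    ring
  have hInt : Integrable (uncurry fun (y : ℝ × E3) (p : Ω × Ω) =>
      (𝐞 (inner ℝ y.2 (Z p.1 - Z p.2) + y.1 * (T p.1 - T p.2)) : ℂ) * ((g y : ℂ) * β p))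
      (volume.prod (μ.prod μ)) := by
    have h0 := hgi.ofReal (𝕜 := ℂ) |>.mul_prod hβi
    refine h0.bdd_mul (c := 1) (Measurable.aestronglyMeasurable (by fun_prop))
      (ae_of_all _ fun q => (norm_fourierChar _).le)
  have hswap : ∫ y, (‖W y‖ ^ 2 : ℂ) * (g y : ℂ) =
      ∫ p, (gaussKer ε (T p.1 - T p.2) : ℂ) * (gaussKer ε (Z p.1 - Z p.2) : ℂ) * β p
        ∂(μ.prod μ) := by
    calc _ = ∫ y, ∫ p, (𝐞 (inner ℝ y.2 (Z p.1 - Z p.2) + y.1 * (T p.1 - T p.2)) : ℂ) *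
          ((g y : ℂ) * β p) ∂(μ.prod μ) := by
          refine integral_congr_ae (ae_of_all _ fun y => ?_)
          simp only
          rw [hWW, ← integral_mul_const]
          refine integral_congr_ae (ae_of_all _ fun p => ?_)
          simp only
          ring
      _ = ∫ p, (∫ y : ℝ × E3, (𝐞 (inner ℝ y.2 (Z p.1 - Z p.2) + y.1 * (T p.1 - T p.2)) : ℂ) *
          ((g y : ℂ) * β p)) ∂(μ.prod μ) := integral_integral_swap hInt
      _ = _ := by
          refine integral_congr_ae (ae_of_all _ fun p => ?_)
          simp only
          rw [← integral_char_mul_gauss hε (T p.1 - T p.2),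
            ← integral_char_mul_gauss hε (Z p.1 - Z p.2), ← integral_prod_mul,
            ← integral_mul_const]
          refine integral_congr_ae (ae_of_all _ fun y => ?_)
          simp only [hg]
          rw [add_comm, AddChar.map_add_eq_mul, Circle.coe_mul]
          have : (inner ℝ y.1 (T p.1 - T p.2) : ℝ) = y.1 * (T p.1 - T p.2) := by
            simp [mul_comm]
          rw [this]
          push_cast
          ring
  have hWb : ∀ y, ‖W y‖ ≤ ∫ P, ‖b P‖ ∂μ := fun y =>
    (norm_integral_le_integral_norm _).trans 
    (le_of_eq (by simp_rw [norm_mul, norm_fourierChar, one_mul]))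
  have hLi : Integrable fun y => ‖W y‖ ^ 2 * g y := by
    refine hgi.bdd_mul (c := (∫ P, ‖b P‖ ∂μ) ^ 2) (by fun_prop) (ae_of_all _ fun y => ?_)
    rw [norm_pow, norm_norm]
    gcongr
    exact hWb y
  calc _ = ∫⁻ y, ENNReal.ofReal (‖W y‖ ^ 2 * g y) := by
        refine lintegral_congr fun y => ?_
        rw [ENNReal.ofReal_mul (p := ‖W y‖ ^ 2) (by positivity),
          ENNReal.ofReal_pow (norm_nonneg _), ofReal_norm]
    _ = ENNReal.ofReal (∫ y, ‖W y‖ ^ 2 * g y) :=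
        (ofReal_integral_eq_lintegral_ofReal hLi
          (ae_of_all _ fun y => mul_nonneg (by positivity) (hg0 y))).symm
    _ = ‖∫ y, (‖W y‖ ^ 2 : ℂ) * (g y : ℂ)‖ₑ := by
        have : ∫ y, (‖W y‖ ^ 2 : ℂ) * (g y : ℂ) = ((∫ y, ‖W y‖ ^ 2 * g y : ℝ) : ℂ) := by
          rw [← integral_complex_ofReal]
          push_cast
          rfl
        rw [this, ← ofReal_norm, Complex.norm_real, Real.norm_of_nonneg
          (integral_nonneg fun y => mul_nonneg (by positivity) (hg0 y))]
    _ ≤ _ := by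
        rw [hswap]
        refine (enorm_integral_le_lintegral_enorm _).trans (le_of_eq ?_)
        refine lintegral_congr fun p => ?_
        simp only [hβ, enorm_mul]
        rw [mul_comm, ← ofReal_norm (gaussKer ε (T p.1 - T p.2) : ℂ),
          ← ofReal_norm (gaussKer ε (Z p.1 - Z p.2) : ℂ), Complex.norm_real, Complex.norm_real,
          Real.norm_of_nonneg (gaussKer_nonneg hε _), Real.norm_of_nonneg (gaussKer_nonneg hε _),
          ← ofReal_norm ((starRingEnd ℂ) (b p.2)), RCLike.norm_conj, ofReal_norm]

end Oscillatory

/-- Schur's test with weight `w` for a symmetric kernel. -/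
lemma lintegral_schur_le {Ω : Type*} [MeasurableSpace Ω] {μ : Measure Ω} [SFinite μ]
    {B w : Ω → ℝ≥0∞} {k : Ω × Ω → ℝ≥0∞} (hB : Measurable B) (hw : Measurable w)
    (hk : Measurable k) (hksymm : ∀ p, k p.swap = k p)
    (hw0 : ∀ᵐ P ∂μ, w P ≠ 0) (hwt : ∀ P, w P ≠ ∞) {M : ℝ≥0∞}
    (hM : ∀ P, ∫⁻ P', (w P')⁻¹ * k (P, P') ∂μ ≤ M) :
    ∫⁻ p, B p.1 * B p.2 * k p ∂(μ.prod μ) ≤ 2 * M * ∫⁻ P, B P ^ 2 * w P ∂μ := by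
  set F : Ω × Ω → ℝ≥0∞ := fun p => B p.1 ^ 2 * w p.1 * ((w p.2)⁻¹ * k p) with hF
  have hFm : Measurable F := by fun_prop
  have h1 : ∫⁻ p, F p ∂(μ.prod μ) ≤ M * ∫⁻ P, B P ^ 2 * w P ∂μ := by
    rw [lintegral_prod _ hFm.aemeasurable, ← lintegral_const_mul _ (by fun_prop)]
    refine lintegral_mono fun P => ?_
    simp only [hF]
    rw [lintegral_const_mul _ (by fun_prop), mul_comm]
    gcongr
    exact hM P
  have h2 : ∫⁻ p, F p.swap ∂(μ.prod μ) = ∫⁻ p, F p ∂(μ.prod μ) := lintegral_prod_swap F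
  have hae : ∀ᵐ p ∂(μ.prod μ), B p.1 * B p.2 * k p ≤ F p + F p.swap := by
    have e1 : ∀ᵐ p ∂(μ.prod μ), w p.1 ≠ 0 := Measure.quasiMeasurePreserving_fst.ae hw0
    have e2 : ∀ᵐ p ∂(μ.prod μ), w p.2 ≠ 0 := Measure.quasiMeasurePreserving_snd.ae hw0
    filter_upwards [e1, e2] with p hp1 hp2
    rcases le_total (B p.1 * w p.1) (B p.2 * w p.2) with h | h
    · have h3 : B p.1 ≤ B p.2 * w p.2 * (w p.1)⁻¹ := by
        rw [← div_eq_mul_inv, ENNReal.le_div_iff_mul_le (Or.inl hp1) (Or.inl (hwt _))]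
        exact h
      refine le_add_left ?_
      simp only [hF, Prod.fst_swap, Prod.snd_swap, hksymm]
      calc B p.1 * B p.2 * k p ≤ (B p.2 * w p.2 * (w p.1)⁻¹) * B p.2 * k p := by gcongr
        _ = _ := by ring
    · have h3 : B p.2 ≤ B p.1 * w p.1 * (w p.2)⁻¹ := by
        rw [← div_eq_mul_inv, ENNReal.le_div_iff_mul_le (Or.inl hp2) (Or.inl (hwt _))]
        exact h
      refine le_add_right ?_
      simp only [hF]
      calc B p.1 * B p.2 * k p ≤ B p.1 * (B p.1 * w p.1 * (w p.2)⁻¹) * k p := by gcongr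
        _ = _ := by ring
  calc _ ≤ ∫⁻ p, F p + F p.swap ∂(μ.prod μ) := lintegral_mono_ae hae
    _ = ∫⁻ p, F p ∂(μ.prod μ) + ∫⁻ p, F p ∂(μ.prod μ) := by
        rw [lintegral_add_left hFm, h2]
    _ ≤ M * ∫⁻ P, B P ^ 2 * w P ∂μ + M * ∫⁻ P, B P ^ 2 * w P ∂μ := by gcongr
    _ = _ := by ring

lemma lintegral_cone_conv_le {ε : ℝ} (hε : 0 < ε) (τ : ℝ) (ζ : E3) :
    ∫⁻ P : E3 × E3, (‖P.1‖ₑ * ‖P.2‖ₑ)⁻¹ * (ENNReal.ofReal (gaussKer ε (τ - (‖P.1‖ + ‖P.2‖))) *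
      ENNReal.ofReal (gaussKer ε (ζ - (P.1 + P.2)))) ≤ ENNReal.ofReal (2 * π) := by
  have hm1 : Measurable fun s : ℝ => ENNReal.ofReal (gaussKer ε s) :=
    (measurable_gaussKer ε).ennreal_ofReal
  have hm3 : Measurable fun s : E3 => ENNReal.ofReal (gaussKer ε s) :=
    (measurable_gaussKer ε).ennreal_ofReal
  have hF : Measurable fun q : E3 × E3 => ‖q.1‖ₑ⁻¹ * ‖q.2 - q.1‖ₑ⁻¹ *
      ENNReal.ofReal (gaussKer ε (τ - (‖q.1‖ + ‖q.2 - q.1‖))) *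
        ENNReal.ofReal (gaussKer ε (ζ - q.2)) :=
    (Measurable.mul (by fun_prop) (hm1.comp (by fun_prop))).mul (hm3.comp (by fun_prop))
  calc _ ≤ ∫⁻ P : E3 × E3, ‖P.1‖ₑ⁻¹ * ‖P.2‖ₑ⁻¹ *
      ENNReal.ofReal (gaussKer ε (τ - (‖P.1‖ + ‖P.2‖))) *
        ENNReal.ofReal (gaussKer ε (ζ - (P.1 + P.2))) := by
        refine lintegral_mono_ae ?_
        have e1 : ∀ᵐ p : E3 × E3, p.1 ≠ 0 :=
          Measure.quasiMeasurePreserving_fst.ae (Measure.ae_ne volume 0)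
        filter_upwards [e1] with p hp
        rw [ENNReal.mul_inv (Or.inl (by simpa using hp)) (Or.inl enorm_ne_top), mul_assoc (_ * _)]
    _ = ∫⁻ ξ : E3, ∫⁻ η : E3, ‖ξ‖ₑ⁻¹ * ‖η‖ₑ⁻¹ *
      ENNReal.ofReal (gaussKer ε (τ - (‖ξ‖ + ‖η‖))) *
        ENNReal.ofReal (gaussKer ε (ζ - (ξ + η))) := by
        rw [Measure.volume_eq_prod]
        refine lintegral_prod _ (Measurable.aemeasurable ?_)
        exact (Measurable.mul (by fun_prop) (hm1.comp (by fun_prop))).mul (hm3.comp (by fun_prop))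
    _ = ∫⁻ ξ : E3, ∫⁻ z : E3, ‖ξ‖ₑ⁻¹ * ‖z - ξ‖ₑ⁻¹ *
      ENNReal.ofReal (gaussKer ε (τ - (‖ξ‖ + ‖z - ξ‖))) *
        ENNReal.ofReal (gaussKer ε (ζ - z)) := by
        refine lintegral_congr fun ξ => ?_
        rw [← lintegral_sub_right_eq_self _ ξ]
        simp only [add_sub_cancel]
    _ = ∫⁻ z : E3, ∫⁻ ξ : E3, ‖ξ‖ₑ⁻¹ * ‖z - ξ‖ₑ⁻¹ *
      ENNReal.ofReal (gaussKer ε (τ - (‖ξ‖ + ‖z - ξ‖))) *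
        ENNReal.ofReal (gaussKer ε (ζ - z)) := lintegral_lintegral_swap hF.aemeasurable
    _ ≤ ∫⁻ z : E3, ENNReal.ofReal (2 * π) * ENNReal.ofReal (gaussKer ε (ζ - z)) := by
        refine lintegral_mono fun z => ?_
        rw [lintegral_mul_const' _ _ ENNReal.ofReal_ne_top]
        gcongr
        refine (lintegral_focal_le z (fun s => ENNReal.ofReal (gaussKer ε (τ - s)))
          (hm1.comp (by fun_prop))).trans (le_of_eq ?_)
        rw [lintegral_sub_left_eq_self (fun s => ENNReal.ofReal (gaussKer ε s)) τ,
          lintegral_gaussKer hε, mul_one]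
    _ = _ := by
        rw [lintegral_const_mul' _ _ ENNReal.ofReal_ne_top,
          lintegral_sub_left_eq_self (fun s => ENNReal.ofReal (gaussKer ε s)) ζ,
          lintegral_gaussKer hε, mul_one]

/-- The half-wave with Fourier amplitude `a`. -/
def halfWave (a : E3 → ℂ) (t : ℝ) (x : E3) : ℂ :=
  waveSum volume id (fun ξ => ‖ξ‖) a t x

lemma continuous_halfWave {a : E3 → ℂ} (ha : Integrable a) :
    Continuous fun y : ℝ × E3 => halfWave a y.1 y.2 :=
  continuous_waveSum measurable_id measurable_norm ha

lemma halfWave_sq (a : E3 → ℂ) (t : ℝ) (x : E3) :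
    halfWave a t x ^ 2 = waveSum (volume.prod volume) (fun P : E3 × E3 => P.1 + P.2)
      (fun P => ‖P.1‖ + ‖P.2‖) (fun P => a P.1 * a P.2) t x := by
  rw [sq, halfWave, waveSum, ← integral_prod_mul, waveSum]
  refine integral_congr_ae (ae_of_all _ fun P => ?_)
  simp only [id]
  rw [mul_mul_mul_comm, ← Circle.coe_mul, ← AddChar.map_add_eq_mul]
  congr 3
  rw [inner_add_right]
  ring

lemma lintegral_gaussKer_prod_le {a : E3 → ℂ} (ham : Measurable a) {ε : ℝ} (hε : 0 < ε) :
    ∫⁻ p : (E3 × E3) × (E3 × E3), ‖a p.1.1 * a p.1.2‖ₑ * ‖a p.2.1 * a p.2.2‖ₑ *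
      (ENNReal.ofReal (gaussKer ε (‖p.1.1‖ + ‖p.1.2‖ - (‖p.2.1‖ + ‖p.2.2‖))) *
        ENNReal.ofReal (gaussKer ε (p.1.1 + p.1.2 - (p.2.1 + p.2.2))))
          ∂((volume : Measure (E3 × E3)).prod volume) ≤
      2 * ENNReal.ofReal (2 * π) * ∫⁻ P : E3 × E3, ‖a P.1 * a P.2‖ₑ ^ 2 * (‖P.1‖ₑ * ‖P.2‖ₑ) := by
  have hB : Measurable fun P : E3 × E3 => ‖a P.1 * a P.2‖ₑ := by fun_prop
  have hw : Measurable fun P : E3 × E3 => ‖P.1‖ₑ * ‖P.2‖ₑ := by fun_prop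
  have hk : Measurable fun p : (E3 × E3) × (E3 × E3) =>
      ENNReal.ofReal (gaussKer ε (‖p.1.1‖ + ‖p.1.2‖ - (‖p.2.1‖ + ‖p.2.2‖))) *
        ENNReal.ofReal (gaussKer ε (p.1.1 + p.1.2 - (p.2.1 + p.2.2))) := by
    have m1 : Measurable fun p : (E3 × E3) × (E3 × E3) =>
        ENNReal.ofReal (gaussKer ε (‖p.1.1‖ + ‖p.1.2‖ - (‖p.2.1‖ + ‖p.2.2‖))) :=
      (measurable_gaussKer (V := ℝ) ε).ennreal_ofReal.comp (by fun_prop)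
    have m2 : Measurable fun p : (E3 × E3) × (E3 × E3) =>
        ENNReal.ofReal (gaussKer ε (p.1.1 + p.1.2 - (p.2.1 + p.2.2))) :=
      (measurable_gaussKer (V := E3) ε).ennreal_ofReal.comp (by fun_prop)
    exact m1.mul m2
  have hw0 : ∀ᵐ P : E3 × E3, ‖P.1‖ₑ * ‖P.2‖ₑ ≠ 0 := by
    have e1 : ∀ᵐ p : E3 × E3, p.1 ≠ 0 :=
      Measure.quasiMeasurePreserving_fst.ae (Measure.ae_ne volume 0)
    have e2 : ∀ᵐ p : E3 × E3, p.2 ≠ 0 :=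
      Measure.quasiMeasurePreserving_snd.ae (Measure.ae_ne volume 0)
    filter_upwards [e1, e2] with p h1 h2
    simp [h1, h2]
  have hM : ∀ P : E3 × E3, ∫⁻ P' : E3 × E3, (‖P'.1‖ₑ * ‖P'.2‖ₑ)⁻¹ *
      (ENNReal.ofReal (gaussKer ε (‖P.1‖ + ‖P.2‖ - (‖P'.1‖ + ‖P'.2‖))) *
        ENNReal.ofReal (gaussKer ε (P.1 + P.2 - (P'.1 + P'.2)))) ≤ ENNReal.ofReal (2 * π) :=
    fun P => lintegral_cone_conv_le hε (‖P.1‖ + ‖P.2‖) (P.1 + P.2)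
  refine lintegral_schur_le hB hw hk ?_ hw0
    (fun P => ENNReal.mul_ne_top enorm_ne_top enorm_ne_top) hM
  intro p
  simp only [Prod.fst_swap, Prod.snd_swap]
  rw [← gaussKer_neg ε (‖p.2.1‖ + ‖p.2.2‖ - (‖p.1.1‖ + ‖p.1.2‖)),
    ← gaussKer_neg ε (p.2.1 + p.2.2 - (p.1.1 + p.1.2)), neg_sub, neg_sub]

lemma lintegral_halfWave_pow_four_gauss_le {a : E3 → ℂ} (ham : Measurable a) (ha : Integrable a)
    {ε : ℝ} (hε : 0 < ε) : ∫⁻ y : ℝ × E3, ‖halfWave a y.1 y.2‖ₑ ^ 4 *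
      ENNReal.ofReal (rexp (-(π * ε) * ‖y.1‖ ^ 2) * rexp (-(π * ε) * ‖y.2‖ ^ 2)) ≤
      ENNReal.ofReal (4 * π) * (∫⁻ ξ, ‖a ξ‖ₑ ^ 2 * ‖ξ‖ₑ) ^ 2 := by
  have hb : Integrable (fun P : E3 × E3 => a P.1 * a P.2) (volume.prod volume) := ha.mul_prod ha
  have hZ : Measurable fun P : E3 × E3 => P.1 + P.2 := by fun_prop
  have hT : Measurable fun P : E3 × E3 => ‖P.1‖ + ‖P.2‖ := by fun_prop
  have h1 := lintegral_waveSum_sq_gauss_le hZ hT hb hε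
  have h2 := lintegral_gaussKer_prod_le ham hε
  have h3 : ∫⁻ P : E3 × E3, ‖a P.1 * a P.2‖ₑ ^ 2 * (‖P.1‖ₑ * ‖P.2‖ₑ) =
      (∫⁻ ξ, ‖a ξ‖ₑ ^ 2 * ‖ξ‖ₑ) ^ 2 := by
    have hm : AEMeasurable (fun ξ : E3 => ‖a ξ‖ₑ ^ 2 * ‖ξ‖ₑ) := by fun_prop
    rw [sq (∫⁻ ξ, ‖a ξ‖ₑ ^ 2 * ‖ξ‖ₑ), ← lintegral_prod_mul hm hm]
    refine lintegral_congr fun P => ?_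
    rw [enorm_mul]
    ring
  have h4 : (2 : ℝ≥0∞) * ENNReal.ofReal (2 * π) = ENNReal.ofReal (4 * π) := by
    rw [← ENNReal.ofReal_ofNat, ← ENNReal.ofReal_mul (by norm_num)]; congr 1; ring
  rw [h3, h4] at h2
  refine le_trans (le_of_eq ?_) (h1.trans h2)
  refine lintegral_congr fun y => ?_
  rw [← halfWave_sq, enorm_pow, ← pow_mul]

/-- The Strichartz estimate `‖e^{it|∇|}f‖_{L⁴(ℝ×ℝ³)} ≲ ‖f‖_{Ḣ^{1/2}}`. -/
lemma lintegral_halfWave_pow_four_le {a : E3 → ℂ} (ham : Measurable a) (ha : Integrable a) :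
    ∫⁻ y : ℝ × E3, ‖halfWave a y.1 y.2‖ₑ ^ 4 ≤
      ENNReal.ofReal (4 * π) * (∫⁻ ξ, ‖a ξ‖ₑ ^ 2 * ‖ξ‖ₑ) ^ 2 := by
  have hc := continuous_halfWave ha
  set G : ℕ → ℝ × E3 → ℝ≥0∞ := fun n y => ‖halfWave a y.1 y.2‖ₑ ^ 4 *
      ENNReal.ofReal (rexp (-(π * (1 / ((n : ℝ) + 1))) * ‖y.1‖ ^ 2) *
        rexp (-(π * (1 / ((n : ℝ) + 1))) * ‖y.2‖ ^ 2)) with hG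
  have hGm : ∀ n, Measurable (G n) := fun n =>
    (hc.measurable.enorm.pow_const 4).mul (by fun_prop)
  have hlim : ∀ y, Filter.Tendsto (fun n => G n y) Filter.atTop
      (nhds (‖halfWave a y.1 y.2‖ₑ ^ 4)) := by
    intro y
    have h0 : Filter.Tendsto (fun n : ℕ => (1 / ((n : ℝ) + 1))) Filter.atTop (nhds 0) :=
      tendsto_one_div_add_atTop_nhds_zero_nat
    have h1 : Filter.Tendsto (fun ε : ℝ => ENNReal.ofReal (rexp (-(π * ε) * ‖y.1‖ ^ 2) *
        rexp (-(π * ε) * ‖y.2‖ ^ 2))) (nhds 0) (nhds 1) := by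
      have : Continuous (fun ε : ℝ => ENNReal.ofReal (rexp (-(π * ε) * ‖y.1‖ ^ 2) *
        rexp (-(π * ε) * ‖y.2‖ ^ 2))) := ENNReal.continuous_ofReal.comp (by fun_prop)
      simpa using this.tendsto 0
    have h2 := ENNReal.Tendsto.const_mul (a := ‖halfWave a y.1 y.2‖ₑ ^ 4) (h1.comp h0)
      (Or.inr (ENNReal.pow_ne_top enorm_ne_top))
    rw [mul_one] at h2
    exact h2
  calc _ = ∫⁻ y, Filter.liminf (fun n => G n y) Filter.atTop :=
        lintegral_congr fun y => (hlim y).liminf_eq.symm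
    _ ≤ Filter.liminf (fun n => ∫⁻ y, G n y) Filter.atTop := lintegral_liminf_le hGm
    _ ≤ _ := by
        refine Filter.liminf_le_of_le (by isBoundedDefault) fun b hb => ?_
        obtain ⟨n, hn⟩ := hb.exists
        exact hn.trans (lintegral_halfWave_pow_four_gauss_le ham ha (by positivity))

/-- Surface measure on the unit sphere of `ℝ³`. -/
def sphMeas : Measure E3 := (μH[2] : Measure E3).restrict (Metric.sphere 0 1)

lemma exists_spherical_coords {x : E3} (hx : ‖x‖ = 1) :
    ∃ p ∈ Icc (fun _ => -π : Fin 2 → ℝ) (fun _ => π),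
      (WithLp.toLp 2 ![sin (p 0) * cos (p 1), sin (p 0) * sin (p 1), cos (p 0)] : E3) = x := by
  have h1 : x 0 ^ 2 + x 1 ^ 2 + x 2 ^ 2 = 1 := by
    have := EuclideanSpace.real_norm_sq_eq x
    rw [hx, Fin.sum_univ_three] at this
    linarith
  set z : ℂ := ⟨x 0, x 1⟩ with hz
  have hz2 : ‖z‖ = √(1 - x 2 ^ 2) := by
    rw [Complex.norm_def, Complex.normSq_mk]
    congr 1
    linarith
  have h2 : -1 ≤ x 2 := by nlinarith [sq_nonneg (x 0), sq_nonneg (x 1)]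
  have h3 : x 2 ≤ 1 := by nlinarith [sq_nonneg (x 0), sq_nonneg (x 1)]
  refine ⟨![arccos (x 2), z.arg], ⟨fun i => ?_, fun i => ?_⟩, ?_⟩
  · fin_cases i
    · simpa using (neg_nonpos.2 pi_pos.le).trans (arccos_nonneg (x 2))
    · simpa using (Complex.neg_pi_lt_arg z).le
  · fin_cases i
    · simpa using arccos_le_pi (x 2)
    · simpa using Complex.arg_le_pi z
  · ext i
    fin_cases i
    · simp [sin_arccos, ← hz2, Complex.norm_mul_cos_arg, hz]
    · simp [sin_arccos, ← hz2, Complex.norm_mul_sin_arg, hz]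
    · simp [cos_arccos h2 h3]

instance : IsFiniteMeasure sphMeas := by
  constructor
  rw [sphMeas, Measure.restrict_apply_univ]
  set g : (Fin 2 → ℝ) → E3 := fun p =>
    WithLp.toLp 2 ![sin (p 0) * cos (p 1), sin (p 0) * sin (p 1), cos (p 0)] with hg
  set K : Set (Fin 2 → ℝ) := Icc (fun _ => -π) (fun _ => π) with hK
  have hgc : ContDiff ℝ 1 g := by
    rw [contDiff_euclidean]
    intro i
    fin_cases i
    · change ContDiff ℝ 1 fun p : Fin 2 → ℝ => sin (p 0) * cos (p 1)
      fun_prop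
    · change ContDiff ℝ 1 fun p : Fin 2 → ℝ => sin (p 0) * sin (p 1)
      fun_prop
    · change ContDiff ℝ 1 fun p : Fin 2 → ℝ => cos (p 0)
      fun_prop
  obtain ⟨L, hL⟩ := (hgc.locallyLipschitz.locallyLipschitzOn (s := K)).exists_lipschitzOnWith_of_compact
    isCompact_Icc
  have h1 : Metric.sphere (0 : E3) 1 ⊆ g '' K := by
    intro x hx
    obtain ⟨p, hp, rfl⟩ := exists_spherical_coords (mem_sphere_zero_iff_norm.1 hx)
    exact ⟨p, hp, rfl⟩
  have h2 := hL.hausdorffMeasure_image_le (d := 2) (by norm_num)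
  have h3 : (μH[2] : Measure (Fin 2 → ℝ)) = volume := by
    have := hausdorffMeasure_pi_real (ι := Fin 2)
    simpa using this
  rw [h3] at h2
  refine (measure_mono h1).trans_lt (h2.trans_lt (ENNReal.mul_lt_top ?_ ?_))
  · exact ENNReal.rpow_lt_top_of_nonneg (by norm_num) ENNReal.coe_ne_top
  · exact isCompact_Icc.measure_lt_top

lemma ae_sphMeas_norm : ∀ᵐ ω ∂sphMeas, ‖ω‖ = 1 := by
  filter_upwards [ae_restrict_mem (μ := (μH[2] : Measure E3)) (Metric.isClosed_sphere (x := (0 : E3))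
    (ε := 1)).measurableSet] with ω hω
  exact mem_sphere_zero_iff_norm.1 hω

lemma map_sphMeas (L : E3 ≃ₗᵢ[ℝ] E3) : sphMeas.map L = sphMeas := by
  have h1 := L.toIsometryEquiv.map_hausdorffMeasure 2
  have h2 : (L : E3 → E3) ⁻¹' Metric.sphere 0 1 = Metric.sphere 0 1 := by
    ext x; simp
  have h3 := Measure.restrict_map (μ := (μH[2] : Measure E3)) (f := L) L.continuous.measurable
    (Metric.isClosed_sphere (x := (0 : E3)) (ε := 1)).measurableSet
  rw [h2] at h3
  rw [sphMeas, ← h3]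
  congr 1

lemma integral_sphMeas_comp {F : Type*} [NormedAddCommGroup F] [NormedSpace ℝ F]
    (L : E3 ≃ₗᵢ[ℝ] E3) (f : E3 → F) : ∫ ω, f (L ω) ∂sphMeas = ∫ ω, f ω ∂sphMeas := by
  conv_rhs => rw [← map_sphMeas L]
  exact (L.toHomeomorph.measurableEmbedding.integral_map f).symm

open scoped Pointwise in
lemma sphInt_eq_integral_sphMeas (x : E3) {r : ℝ} (hr : 0 < r) (f : E3 → ℝ) :
    sphInt x r f = r ^ 2 * ∫ ω, f (x + r • ω) ∂sphMeas := by
  set φ : E3 ≃ₜ E3 := (Homeomorph.smulOfNeZero r hr.ne').trans (Homeomorph.addLeft x) with hφ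
  have hφa : ∀ ω, φ ω = x + r • ω := fun ω => rfl
  have key : (μH[2] : Measure E3).restrict (Metric.sphere x r) =
      ENNReal.ofReal (r ^ 2) • sphMeas.map φ := by
    ext s hs
    have hms : MeasurableSet (φ ⁻¹' s) := φ.measurable hs
    rw [Measure.smul_apply, Measure.map_apply φ.measurable hs, sphMeas,
      Measure.restrict_apply hs, Measure.restrict_apply hms]
    have e1 : s ∩ Metric.sphere x r =
        (x + ·) '' (r • (φ ⁻¹' s ∩ Metric.sphere (0 : E3) 1)) := by
      ext y
      constructor
      · rintro ⟨h1, h2⟩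
        refine ⟨y - x, ⟨r⁻¹ • (y - x), ⟨?_, ?_⟩, ?_⟩, ?_⟩
        · simpa [hφa, smul_smul, hr.ne'] using h1
        · rw [mem_sphere_iff_norm] at h2
          rw [mem_sphere_zero_iff_norm, norm_smul, h2, norm_inv, norm_of_nonneg hr.le,
            inv_mul_cancel₀ hr.ne']
        · simp [smul_smul, hr.ne']
        · simp
      · rintro ⟨_, ⟨ω, ⟨h1, h2⟩, rfl⟩, rfl⟩
        refine ⟨h1, ?_⟩
        rw [mem_sphere_zero_iff_norm] at h2
        simp [norm_smul, h2, abs_of_pos hr]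
    rw [e1, (isometry_add_left x).hausdorffMeasure_image (Or.inl zero_le_two),
      Measure.hausdorffMeasure_smul₀ zero_le_two hr.ne', ENNReal.smul_def, ENNReal.ofReal]
    congr 2
    ext
    simp [abs_of_pos hr, hr.le]
  rw [sphInt, key, integral_smul_measure, φ.measurableEmbedding.integral_map,
    ENNReal.toReal_ofReal (by positivity), smul_eq_mul]
  rfl

lemma integrable_sphMeas {F : Type*} [NormedAddCommGroup F] {f : E3 → F} (hf : Continuous f) : Integrable f sphMeas := by
  have h : IntegrableOn f (Metric.sphere 0 1) sphMeas :=
    hf.continuousOn.integrableOn_compact (isCompact_sphere 0 1)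
  rwa [IntegrableOn, sphMeas, Measure.restrict_restrict
    (Metric.isClosed_sphere (x := (0 : E3)) (ε := 1)).measurableSet, inter_self] at h

section Leibniz

variable {F : Type*} [NormedAddCommGroup F] [NormedSpace ℝ F]

lemma continuous_integral_sphMeas {X : Type*} [TopologicalSpace X] [FirstCountableTopology X]
    [LocallyCompactSpace X] {f : X → E3 → F} (hf : Continuous (uncurry f)) :
    Continuous fun p => ∫ ω, f p ω ∂sphMeas := by
  have h := continuous_parametric_integral_of_continuous (μ := sphMeas) hf
    (isCompact_sphere (0 : E3) 1)
  simpa only [sphMeas, Measure.restrict_restrict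
    (Metric.isClosed_sphere (x := (0 : E3)) (ε := 1)).measurableSet, inter_self] using h

lemma hasDerivAt_integral_sphMeas {f f' : ℝ → E3 → F} (hf : Continuous (uncurry f))
    (hf' : Continuous (uncurry f')) (hd : ∀ τ ω, HasDerivAt (f · ω) (f' τ ω) τ) (τ : ℝ) :
    HasDerivAt (fun τ => ∫ ω, f τ ω ∂sphMeas) (∫ ω, f' τ ω ∂sphMeas) τ := by
  obtain ⟨C, hC⟩ := ((isCompact_closedBall τ 1).prod (isCompact_sphere (0 : E3) 1)).exists_bound_of_continuousOn
    hf'.continuousOn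
  have hs : ∀ t, Continuous (f t) := fun t => hf.comp (by fun_prop : Continuous fun ω => (t, ω))
  have hs' : ∀ t, Continuous (f' t) := fun t => hf'.comp (by fun_prop : Continuous fun ω => (t, ω))
  refine (hasDerivAt_integral_of_dominated_loc_of_deriv_le (bound := fun _ => C)
    (Metric.closedBall_mem_nhds τ one_pos)
    (Filter.Eventually.of_forall fun t => (integrable_sphMeas (hs t)).aestronglyMeasurable)
    (integrable_sphMeas (hs τ)) (integrable_sphMeas (hs' τ)).aestronglyMeasurable ?_
    (integrable_const C) (Filter.Eventually.of_forall fun ω t _ => hd t ω)).2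
  filter_upwards [ae_sphMeas_norm] with ω hω t ht
  exact hC (t, ω) ⟨ht, mem_sphere_zero_iff_norm.2 hω⟩

end Leibniz


/-- The standard basis vectors of `ℝ³`. -/
abbrev stdVec (i : Fin 3) : E3 := EuclideanSpace.single i 1

/-- The generator of the rotations in the `(i, j)` coordinate plane. -/
def rotGen (i j : Fin 3) (ω : E3) : E3 := ω i • stdVec j - ω j • stdVec i

/-- The square of `rotGen i j`, for `i ≠ j`. -/
def rotGenSq (i j : Fin 3) (ω : E3) : E3 := -(ω i • stdVec i) - ω j • stdVec j

/-- The rotation by the angle `θ` in the `(i, j)` coordinate plane. -/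
def rot {i j : Fin 3} (h : i ≠ j) (θ : ℝ) : E3 ≃ₗᵢ[ℝ] E3 :=
  LinearIsometry.toLinearIsometryEquiv (F := E3)
    { toFun := fun ω => ω + sin θ • rotGen i j ω + (1 - cos θ) • rotGenSq i j ω
      map_add' := fun a b => by
        simp only [rotGen, rotGenSq, PiLp.add_apply]
        module
      map_smul' := fun c a => by
        simp only [rotGen, rotGenSq, PiLp.smul_apply, smul_eq_mul, RingHom.id_apply]
        module
      norm_map' := fun a => by
        have hs := sin_sq_add_cos_sq θ
        simp only
        generalize sin θ = S, cos θ = K at hs ⊢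
        have e : (a i ^ 2 + a j ^ 2) * (S ^ 2 + K ^ 2 - 1) = 0 := by rw [hs]; ring
        refine (sq_eq_sq₀ (norm_nonneg _) (norm_nonneg _)).1 ?_
        rw [EuclideanSpace.real_norm_sq_eq, EuclideanSpace.real_norm_sq_eq, Fin.sum_univ_three,
          Fin.sum_univ_three]
        fin_cases i <;> fin_cases j <;>
          simp [rotGen, rotGenSq, -mul_eq_zero] at h e ⊢ <;> linear_combination e }
    rfl

@[fun_prop]
lemma continuous_rotGen (i j : Fin 3) : Continuous (rotGen i j) := by
  unfold rotGen; fun_prop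

@[fun_prop]
lemma continuous_rotGenSq (i j : Fin 3) : Continuous (rotGenSq i j) := by
  unfold rotGenSq; fun_prop

section EPD

variable {F : Type*} [NormedAddCommGroup F] [NormedSpace ℝ F]

lemma integral_sphMeas_fderiv_const (T : E3 →L[ℝ] F) : ∫ ω, T ω ∂sphMeas = 0 := by
  have h := integral_sphMeas_comp (LinearIsometryEquiv.neg ℝ) T
  simp only [LinearIsometryEquiv.coe_neg, map_neg, integral_neg] at h
  have h2 : (2 : ℝ) • ∫ ω, T ω ∂sphMeas = 0 := by
    rw [two_smul]; nth_rewrite 1 [← h]; exact neg_add_cancel _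
  exact (smul_eq_zero_iff_right two_ne_zero).1 h2

lemma integral_rotGen {f : E3 → F} (hf : ContDiff ℝ 2 f) (x : E3) (r : ℝ) {i j : Fin 3}
    (h : i ≠ j) :
    ∫ ω, (r ^ 2 • fderiv ℝ (fderiv ℝ f) (x + r • ω) (rotGen i j ω) (rotGen i j ω) +
      r • fderiv ℝ f (x + r • ω) (rotGenSq i j ω)) ∂sphMeas = 0 := by
  have hd0 : Differentiable ℝ f := hf.differentiable (by norm_num)
  have hc1 : ContDiff ℝ 1 (fderiv ℝ f) := hf.fderiv_right (by norm_num)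
  have hd1 : Differentiable ℝ (fderiv ℝ f) := hc1.differentiable (by norm_num)
  have hcf : Continuous (fderiv ℝ f) := hc1.continuous
  have hcff : Continuous (fderiv ℝ (fderiv ℝ f)) := hc1.continuous_fderiv (by norm_num)
  set γ : ℝ → E3 → E3 := fun θ ω =>
    x + r • (ω + sin θ • rotGen i j ω + (1 - cos θ) • rotGenSq i j ω) with hγ
  set γ' : ℝ → E3 → E3 := fun θ ω => r • (cos θ • rotGen i j ω + sin θ • rotGenSq i j ω) with hγ'
  set γ'' : ℝ → E3 → E3 := fun θ ω =>
    r • (-sin θ • rotGen i j ω + cos θ • rotGenSq i j ω) with hγ''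
  have hγd : ∀ θ ω, HasDerivAt (γ · ω) (γ' θ ω) θ := by
    intro θ ω
    have h1 := (hasDerivAt_sin θ).smul_const (rotGen i j ω)
    have h2 := ((hasDerivAt_cos θ).const_sub 1).smul_const (rotGenSq i j ω)
    have h3 := (((h1.const_add ω).add h2).const_smul r).const_add x
    simpa [hγ, hγ'] using h3
  have hγ'd : ∀ θ ω, HasDerivAt (γ' · ω) (γ'' θ ω) θ := by
    intro θ ω
    have h1 := (hasDerivAt_cos θ).smul_const (rotGen i j ω)
    have h2 := (hasDerivAt_sin θ).smul_const (rotGenSq i j ω)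
    exact (h1.add h2).const_smul r
  have c0 : Continuous (uncurry γ) := by
    simp only [hγ, uncurry_def]; fun_prop
  have c1 : Continuous (uncurry γ') := by
    simp only [hγ', uncurry_def]; fun_prop
  have c2 : Continuous (uncurry γ'') := by
    simp only [hγ'', uncurry_def]; fun_prop
  have k1 : Continuous (uncurry fun θ ω => fderiv ℝ f (γ θ ω) (γ' θ ω)) :=
    (hcf.comp c0).clm_apply c1
  have k2 : Continuous (uncurry fun θ ω => fderiv ℝ (fderiv ℝ f) (γ θ ω) (γ' θ ω) (γ' θ ω) +
      fderiv ℝ f (γ θ ω) (γ'' θ ω)) :=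
    (((hcff.comp c0).clm_apply c1).clm_apply c1).add ((hcf.comp c0).clm_apply c2)
  have I1 : ∀ θ, HasDerivAt (fun θ => ∫ ω, f (γ θ ω) ∂sphMeas)
      (∫ ω, fderiv ℝ f (γ θ ω) (γ' θ ω) ∂sphMeas) θ :=
    hasDerivAt_integral_sphMeas (f := fun θ ω => f (γ θ ω)) (hd0.continuous.comp c0) k1
      fun θ ω => (hd0 _).hasFDerivAt.comp_hasDerivAt θ (hγd θ ω)
  have I2 : ∀ θ, HasDerivAt (fun θ => ∫ ω, fderiv ℝ f (γ θ ω) (γ' θ ω) ∂sphMeas)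
      (∫ ω, (fderiv ℝ (fderiv ℝ f) (γ θ ω) (γ' θ ω) (γ' θ ω) +
        fderiv ℝ f (γ θ ω) (γ'' θ ω)) ∂sphMeas) θ :=
    hasDerivAt_integral_sphMeas (f := fun θ ω => fderiv ℝ f (γ θ ω) (γ' θ ω)) k1 k2
      fun θ ω => (((hd1 _).hasFDerivAt.comp_hasDerivAt θ (hγd θ ω))).clm_apply (hγ'd θ ω)
  have E0 : (fun θ => ∫ ω, f (γ θ ω) ∂sphMeas) = fun _ => ∫ ω, f (x + r • ω) ∂sphMeas := by
    funext θ
    exact integral_sphMeas_comp (rot h θ) fun ω => f (x + r • ω)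
  have E1 : (fun θ => ∫ ω, fderiv ℝ f (γ θ ω) (γ' θ ω) ∂sphMeas) = fun _ => 0 := by
    funext θ
    have := I1 θ
    rw [E0] at this
    exact this.unique (hasDerivAt_const θ _)
  have E2 := I2 0
  rw [E1] at E2
  have E3 := E2.unique (hasDerivAt_const 0 _)
  rw [← E3]
  refine integral_congr_ae (ae_of_all _ fun ω => ?_)
  simp [hγ, hγ', hγ'', smul_smul, sq]

lemma sum_bilin_rotGen (B : E3 →L[ℝ] E3 →L[ℝ] F) {ω : E3} (hω : ‖ω‖ = 1) :
    B (rotGen 0 1 ω) (rotGen 0 1 ω) + B (rotGen 1 2 ω) (rotGen 1 2 ω) +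
      B (rotGen 2 0 ω) (rotGen 2 0 ω) = ∑ i, B (stdVec i) (stdVec i) - B ω ω := by
  have h1 : ω 0 ^ 2 + ω 1 ^ 2 + ω 2 ^ 2 = 1 := by
    have := EuclideanSpace.real_norm_sq_eq ω
    rw [hω, Fin.sum_univ_three] at this
    linarith
  have h2 : ω = ω 0 • stdVec 0 + ω 1 • stdVec 1 + ω 2 • stdVec 2 := by
    ext i; fin_cases i <;> simp
  have h3 : B ω ω = B (ω 0 • stdVec 0 + ω 1 • stdVec 1 + ω 2 • stdVec 2)
      (ω 0 • stdVec 0 + ω 1 • stdVec 1 + ω 2 • stdVec 2) := by rw [← h2]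
  have h4 : ∑ i, B (stdVec i) (stdVec i) =
      (ω 0 ^ 2 + ω 1 ^ 2 + ω 2 ^ 2) • ∑ i, B (stdVec i) (stdVec i) := by rw [h1, one_smul]
  rw [h3, h4, Fin.sum_univ_three]
  simp only [rotGen, map_add, map_sub, map_smul, _root_.add_apply,
    _root_.sub_apply, _root_.smul_apply]
  module

/-- The Euler–Poisson–Darboux identity for spherical means. -/
lemma integral_sphMeas_epd {f : E3 → F} (hf : ContDiff ℝ 2 f) (x : E3) (r : ℝ) :
    ∫ ω, (r • fderiv ℝ (fderiv ℝ f) (x + r • ω) ω ω + (2 : ℝ) • fderiv ℝ f (x + r • ω) ω) ∂sphMeas =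
      r • ∫ ω, ∑ i, fderiv ℝ (fderiv ℝ f) (x + r • ω) (stdVec i) (stdVec i) ∂sphMeas := by
  have hc1 : ContDiff ℝ 1 (fderiv ℝ f) := hf.fderiv_right (by norm_num)
  have hcf : Continuous fun ω => fderiv ℝ f (x + r • ω) := hc1.continuous.comp (by fun_prop)
  have hcff : Continuous fun ω => fderiv ℝ (fderiv ℝ f) (x + r • ω) :=
    (hc1.continuous_fderiv (by norm_num)).comp (by fun_prop)
  rcases eq_or_ne r 0 with rfl | hr
  · have h := integral_sphMeas_fderiv_const (fderiv ℝ f x)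
    simp [integral_smul, h]
  have hInt : ∀ i j, Integrable (fun ω =>
      r ^ 2 • fderiv ℝ (fderiv ℝ f) (x + r • ω) (rotGen i j ω) (rotGen i j ω) +
      r • fderiv ℝ f (x + r • ω) (rotGenSq i j ω)) sphMeas := fun i j =>
    integrable_sphMeas ((((hcff.clm_apply (by fun_prop)).clm_apply (by fun_prop)).const_smul _).add
      ((hcf.clm_apply (by fun_prop)).const_smul _))
  have i1 : Integrable (fun ω =>
      r • fderiv ℝ (fderiv ℝ f) (x + r • ω) ω ω + (2 : ℝ) • fderiv ℝ f (x + r • ω) ω) sphMeas :=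
    integrable_sphMeas ((((hcff.clm_apply (by fun_prop)).clm_apply (by fun_prop)).const_smul _).add
      ((hcf.clm_apply (by fun_prop)).const_smul _))
  have i2 : Integrable (fun ω =>
      r • ∑ i, fderiv ℝ (fderiv ℝ f) (x + r • ω) (stdVec i) (stdVec i)) sphMeas :=
    integrable_sphMeas ((continuous_finsetSum _ fun i _ =>
      (hcff.clm_apply (by fun_prop)).clm_apply (by fun_prop)).const_smul r)
  set g : Fin 3 → Fin 3 → E3 → F := fun i j ω =>
      r ^ 2 • fderiv ℝ (fderiv ℝ f) (x + r • ω) (rotGen i j ω) (rotGen i j ω) +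
      r • fderiv ℝ f (x + r • ω) (rotGenSq i j ω) with hg
  have hg0 : ∀ {i j : Fin 3}, i ≠ j → ∫ ω, g i j ω ∂sphMeas = 0 := fun h =>
    integral_rotGen hf x r h
  have hsum : ∫ ω, (g 0 1 ω + g 1 2 ω) + g 2 0 ω ∂sphMeas = 0 := by
    have e1 : ∫ ω, g 0 1 ω + g 1 2 ω ∂sphMeas = 0 := by
      rw [integral_add (hInt 0 1) (hInt 1 2), hg0 (by decide), hg0 (by decide), add_zero]
    have e2 := integral_add ((hInt 0 1).add (hInt 1 2)) (hInt 2 0)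
    rw [hg0 (by decide), add_zero] at e2
    exact e2.trans e1
  rw [← sub_eq_zero, ← integral_smul, ← integral_sub i1 i2]
  have hr' : -r ≠ 0 := neg_ne_zero.2 hr
  refine (smul_eq_zero_iff_right hr').1 ?_
  rw [← integral_smul, ← hsum]
  refine integral_congr_ae ?_
  filter_upwards [ae_sphMeas_norm] with ω hω
  have h1 := sum_bilin_rotGen (fderiv ℝ (fderiv ℝ f) (x + r • ω)) hω
  have h2 : ω = -(1/2 : ℝ) • (rotGenSq 0 1 ω + rotGenSq 1 2 ω + rotGenSq 2 0 ω) := by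
    ext i; fin_cases i <;> simp [rotGenSq] <;> ring
  have h3 : (2 : ℝ) • fderiv ℝ f (x + r • ω) ω = -(fderiv ℝ f (x + r • ω) (rotGenSq 0 1 ω) +
      fderiv ℝ f (x + r • ω) (rotGenSq 1 2 ω) + fderiv ℝ f (x + r • ω) (rotGenSq 2 0 ω)) := by
    conv_lhs => arg 2; arg 2; rw [h2]
    simp only [map_add, map_smul]
    module
  have h4 : fderiv ℝ (fderiv ℝ f) (x + r • ω) ω ω =
      ∑ i, fderiv ℝ (fderiv ℝ f) (x + r • ω) (stdVec i) (stdVec i) -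
      (fderiv ℝ (fderiv ℝ f) (x + r • ω) (rotGen 0 1 ω) (rotGen 0 1 ω) +
      fderiv ℝ (fderiv ℝ f) (x + r • ω) (rotGen 1 2 ω) (rotGen 1 2 ω) +
      fderiv ℝ (fderiv ℝ f) (x + r • ω) (rotGen 2 0 ω) (rotGen 2 0 ω)) := by
    rw [h1]; abel
  change -r • (r • fderiv ℝ (fderiv ℝ f) (x + r • ω) ω ω + (2 : ℝ) • fderiv ℝ f (x + r • ω) ω -
    r • ∑ i, fderiv ℝ (fderiv ℝ f) (x + r • ω) (stdVec i) (stdVec i)) = _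
  rw [h3, h4]
  simp only [hg]
  module

end EPD


lemma eq_cos_sin_of_hasDerivAt {k : ℝ} {w v : ℝ → ℂ} {m : ℂ} (hw : ∀ r, HasDerivAt w (v r) r)
    (hv : ∀ r, HasDerivAt v (-(k ^ 2 : ℝ) * w r) r) (hw0 : w 0 = 0) (hv0 : v 0 = m) (r : ℝ) :
    v r = m * (cos (k * r) : ℝ) ∧ k * w r = m * (sin (k * r) : ℝ) := by
  have hc : ∀ r : ℝ, HasDerivAt (fun r : ℝ => ((cos (k * r) : ℝ) : ℂ))
      (((-sin (k * r) * k : ℝ)) : ℂ) r := fun r => by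
    have := ((hasDerivAt_id r).const_mul k).cos.ofReal_comp
    simpa using this
  have hs : ∀ r : ℝ, HasDerivAt (fun r : ℝ => ((sin (k * r) : ℝ) : ℂ))
      (((cos (k * r) * k : ℝ)) : ℂ) r := fun r => by
    have := ((hasDerivAt_id r).const_mul k).sin.ofReal_comp
    simpa using this
  have hA : ∀ r : ℝ, HasDerivAt
      (fun r => v r * (cos (k * r) : ℝ) + k * w r * (sin (k * r) : ℝ)) 0 r := fun r => by
    have := ((hv r).mul (hc r)).add (((hw r).const_mul (k : ℂ)).mul (hs r))
    refine this.congr_deriv ?_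
    push_cast
    ring
  have hB : ∀ r : ℝ, HasDerivAt
      (fun r => v r * (sin (k * r) : ℝ) - k * w r * (cos (k * r) : ℝ)) 0 r := fun r => by
    have := ((hv r).mul (hs r)).sub (((hw r).const_mul (k : ℂ)).mul (hc r))
    refine this.congr_deriv ?_
    push_cast
    ring
  have eA := is_const_of_deriv_eq_zero (fun r => (hA r).differentiableAt)
    (fun r => (hA r).deriv) r 0
  have eB := is_const_of_deriv_eq_zero (fun r => (hB r).differentiableAt)
    (fun r => (hB r).deriv) r 0
  simp only [hw0, hv0, mul_zero, cos_zero, sin_zero, Complex.ofReal_one, Complex.ofReal_zero,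
    mul_one, add_zero, sub_zero] at eA eB
  have hcs : ((sin (k * r) : ℝ) : ℂ) ^ 2 + ((cos (k * r) : ℝ) : ℂ) ^ 2 = 1 := by
    exact_mod_cast sin_sq_add_cos_sq (k * r)
  constructor
  · linear_combination ((cos (k * r) : ℝ) : ℂ) * eA + ((sin (k * r) : ℝ) : ℂ) * eB - v r * hcs
  · linear_combination ((sin (k * r) : ℝ) : ℂ) * eA - ((cos (k * r) : ℝ) : ℂ) * eB - k * w r * hcs

/-- The linear form whose exponential is the character of frequency `ξ`. -/
def charForm (ξ : E3) : E3 →L[ℝ] ℂ :=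
  (2 * π * Complex.I : ℂ) • (Complex.ofRealCLM.comp (innerSL ℝ ξ))

lemma charForm_apply (ξ y : E3) : charForm ξ y = 2 * π * Complex.I * (inner ℝ y ξ : ℝ) := by
  simp [charForm, real_inner_comm]

lemma fourierChar_eq_cexp (ξ y : E3) : (𝐞 (inner ℝ y ξ) : ℂ) = Complex.exp (charForm ξ y) := by
  rw [Real.fourierChar_apply, charForm_apply]
  congr 1
  push_cast
  ring

lemma fderiv_cexp_charForm (ξ : E3) :
    fderiv ℝ (fun y => Complex.exp (charForm ξ y)) =
      fun y => Complex.exp (charForm ξ y) • charForm ξ := by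
  funext y
  exact ((charForm ξ).hasFDerivAt.cexp).fderiv

lemma fderiv_fderiv_cexp_charForm (ξ y v w : E3) :
    fderiv ℝ (fderiv ℝ fun y => Complex.exp (charForm ξ y)) y v w =
      Complex.exp (charForm ξ y) * charForm ξ v * charForm ξ w := by
  rw [fderiv_cexp_charForm]
  have h : HasFDerivAt (fun y => Complex.exp (charForm ξ y) • charForm ξ)
      ((Complex.exp (charForm ξ y) • charForm ξ).smulRight (charForm ξ)) y :=
    ((charForm ξ).hasFDerivAt.cexp).smul_const (charForm ξ)
  rw [h.fderiv]
  simp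

lemma sum_charForm_sq (ξ : E3) :
    ∑ i, charForm ξ (stdVec i) * charForm ξ (stdVec i) = -((2 * π * ‖ξ‖) ^ 2 : ℝ) := by
  have h := EuclideanSpace.real_norm_sq_eq ξ
  rw [mul_pow, h, Fin.sum_univ_three, Fin.sum_univ_three]
  simp only [charForm_apply]
  have h1 : ∀ i, inner ℝ (stdVec i) ξ = ξ i := fun i => by
    rw [EuclideanSpace.inner_single_left]; simp
  rw [h1, h1, h1]
  push_cast
  linear_combination (4 * π ^ 2 * (ξ 0 ^ 2 + ξ 1 ^ 2 + ξ 2 ^ 2) : ℂ) * Complex.I_sq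

lemma integral_sphMeas_char (ξ : E3) (r : ℝ) :
    ∫ ω, Complex.exp (charForm ξ (r • ω)) * (1 + r * charForm ξ ω) ∂sphMeas =
        sphMeas.real univ * (cos (2 * π * ‖ξ‖ * r) : ℝ) ∧
      (2 * π * ‖ξ‖ : ℝ) * ∫ ω, r * Complex.exp (charForm ξ (r • ω)) ∂sphMeas =
        sphMeas.real univ * (sin (2 * π * ‖ξ‖ * r) : ℝ) := by
  have hT : ∀ (τ : ℝ) (ω : E3), HasDerivAt (fun r : ℝ => Complex.exp (charForm ξ (r • ω)))
      (Complex.exp (charForm ξ (τ • ω)) * charForm ξ ω) τ := fun τ ω => by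
    have h1 : HasDerivAt (fun r : ℝ => charForm ξ (r • ω)) (charForm ξ ω) τ := by
      have := (charForm ξ).hasFDerivAt.comp_hasDerivAt τ ((hasDerivAt_id τ).smul_const ω)
      rw [one_smul] at this
      exact this
    exact h1.cexp
  have hid : ∀ τ : ℝ, HasDerivAt (fun r : ℝ => (r : ℂ)) 1 τ := fun τ =>
    (hasDerivAt_id τ).ofReal_comp
  have d1 : ∀ (τ : ℝ) (ω : E3), HasDerivAt (fun r : ℝ => r * Complex.exp (charForm ξ (r • ω)))
      (Complex.exp (charForm ξ (τ • ω)) * (1 + τ * charForm ξ ω)) τ := fun τ ω => by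
    refine ((hid τ).mul (hT τ ω)).congr_deriv ?_
    ring
  have d2 : ∀ (τ : ℝ) (ω : E3), HasDerivAt
      (fun r : ℝ => Complex.exp (charForm ξ (r • ω)) * (1 + r * charForm ξ ω))
      (Complex.exp (charForm ξ (τ • ω)) *
        (τ * charForm ξ ω * charForm ξ ω + 2 * charForm ξ ω)) τ := fun τ ω => by
    refine ((hT τ ω).mul (((hid τ).mul_const (charForm ξ ω)).const_add 1)).congr_deriv ?_
    ring
  have c0 : Continuous (uncurry fun (r : ℝ) (ω : E3) =>
      r * Complex.exp (charForm ξ (r • ω))) := by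
    simp only [uncurry_def]; fun_prop
  have c1 : Continuous (uncurry fun (r : ℝ) (ω : E3) =>
      Complex.exp (charForm ξ (r • ω)) * (1 + r * charForm ξ ω)) := by
    simp only [uncurry_def]; fun_prop
  have c2 : Continuous (uncurry fun (r : ℝ) (ω : E3) => Complex.exp (charForm ξ (r • ω)) *
        (r * charForm ξ ω * charForm ξ ω + 2 * charForm ξ ω)) := by
    simp only [uncurry_def]; fun_prop
  refine eq_cos_sin_of_hasDerivAt (k := 2 * π * ‖ξ‖)
    (w := fun r => ∫ ω, r * Complex.exp (charForm ξ (r • ω)) ∂sphMeas)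
    (v := fun r => ∫ ω, Complex.exp (charForm ξ (r • ω)) * (1 + r * charForm ξ ω) ∂sphMeas)
    (hasDerivAt_integral_sphMeas c0 c1 d1) (fun r => ?_) (by simp) (by simp [Measure.real]) r
  refine (hasDerivAt_integral_sphMeas c1 c2 d2 r).congr_deriv ?_
  have hf : ContDiff ℝ 2 fun y => Complex.exp (charForm ξ y) := (charForm ξ).contDiff.cexp
  have e := integral_sphMeas_epd hf 0 r
  simp only [fderiv_fderiv_cexp_charForm, zero_add] at e
  have e1 : ∀ ω, ∑ i, Complex.exp (charForm ξ (r • ω)) * charForm ξ (stdVec i) *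
      charForm ξ (stdVec i) = -((2 * π * ‖ξ‖) ^ 2 : ℝ) * Complex.exp (charForm ξ (r • ω)) := by
    intro ω
    simp only [mul_assoc]
    rw [← Finset.mul_sum, sum_charForm_sq, mul_comm, mul_assoc (2 : ℝ)]
  have e2 : ∫ ω, Complex.exp (charForm ξ (r • ω)) *
      (r * charForm ξ ω * charForm ξ ω + 2 * charForm ξ ω) ∂sphMeas =
      ∫ ω, (r • (Complex.exp (charForm ξ (r • ω)) * charForm ξ ω * charForm ξ ω) +
        (2 : ℝ) • fderiv ℝ (fun y => Complex.exp (charForm ξ y)) (r • ω) ω) ∂sphMeas := by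
    refine integral_congr_ae (ae_of_all _ fun ω => ?_)
    simp only [fderiv_cexp_charForm, Complex.real_smul, _root_.smul_apply, smul_eq_mul]
    push_cast
    ring
  rw [e2, e]
  simp only [e1]
  rw [integral_const_mul, integral_const_mul, Complex.real_smul]
  ring


/-- Kirchhoff's formula, up to normalization, for the free wave with data `(g, h)`. -/
def kirchhoff (g h : E3 → ℝ) (r : ℝ) (x : E3) : ℝ :=
  ∫ ω, (r * h (x + r • ω) + g (x + r • ω) + r * fderiv ℝ g (x + r • ω) ω) ∂sphMeas

section Duhamel

variable {u : ℝ → E3 → ℝ}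

lemma hasFDerivAt_slice {G : Type*} [NormedAddCommGroup G] [NormedSpace ℝ G]
    {U : ℝ × E3 → G} (hU : Differentiable ℝ U) (τ : ℝ) (y : E3) :
    HasFDerivAt (fun y => U (τ, y)) ((fderiv ℝ U (τ, y)).comp (.inr ℝ ℝ E3)) y :=
  (hU (τ, y)).hasFDerivAt.comp y (hasFDerivAt_prodMk_right τ y)

lemma hasDerivAt_slice {G : Type*} [NormedAddCommGroup G] [NormedSpace ℝ G]
    {U : ℝ × E3 → G} (hU : Differentiable ℝ U) (τ : ℝ) (y : E3) :
    HasDerivAt (fun τ => U (τ, y)) (fderiv ℝ U (τ, y) (1, 0)) τ :=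
  (hU (τ, y)).hasFDerivAt.comp_hasDerivAt τ ((hasDerivAt_id τ).prodMk (hasDerivAt_const τ y))

lemma tderiv_eq (hu : ContDiff ℝ 3 (uncurry u)) (τ : ℝ) (y : E3) :
    tderiv u τ y = fderiv ℝ (uncurry u) (τ, y) (1, 0) :=
  (hasDerivAt_slice (hu.differentiable (by norm_num)) τ y).deriv

lemma fderiv_slice_eq (hu : ContDiff ℝ 3 (uncurry u)) (τ : ℝ) (y v : E3) :
    fderiv ℝ (u τ) y v = fderiv ℝ (uncurry u) (τ, y) (0, v) := by
  have h : HasFDerivAt (u τ) _ y :=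
    hasFDerivAt_slice (hu.differentiable (by norm_num)) τ y
  rw [h.fderiv]
  rfl

lemma tderiv2_eq (hu : ContDiff ℝ 3 (uncurry u)) (τ : ℝ) (y : E3) :
    tderiv2 u τ y = fderiv ℝ (fderiv ℝ (uncurry u)) (τ, y) (1, 0) (1, 0) := by
  have h1 : (fun s => tderiv u s y) = fun s => fderiv ℝ (uncurry u) (s, y) (1, 0) :=
    funext fun s => tderiv_eq hu s y
  have hc : ContDiff ℝ 2 (fderiv ℝ (uncurry u)) := hu.fderiv_right (by norm_num)
  rw [tderiv2, h1]
  have h2 := (hasDerivAt_slice (hc.differentiable (by norm_num)) τ y).clm_apply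
    (hasDerivAt_const τ ((1 : ℝ), (0 : E3)))
  rw [h2.deriv]
  simp

lemma fderiv_fderiv_slice_eq (hu : ContDiff ℝ 3 (uncurry u)) (τ : ℝ) (y v w : E3) :
    fderiv ℝ (fderiv ℝ (u τ)) y v w =
      fderiv ℝ (fderiv ℝ (uncurry u)) (τ, y) (0, v) (0, w) := by
  have hc : ContDiff ℝ 2 (fderiv ℝ (uncurry u)) := hu.fderiv_right (by norm_num)
  have h1 : fderiv ℝ (u τ) = fun y => (fderiv ℝ (uncurry u) (τ, y)).comp (.inr ℝ ℝ E3) :=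
    funext fun y => ContinuousLinearMap.ext fun v => fderiv_slice_eq hu τ y v
  rw [h1]
  have h2 := (hasFDerivAt_slice (hc.differentiable (by norm_num)) τ y).clm_comp
    (hasFDerivAt_const (ContinuousLinearMap.inr ℝ ℝ E3) y)
  rw [h2.fderiv]
  simp

lemma lap_eq (f : E3 → ℝ) (y : E3) :
    lap f y = ∑ i, fderiv ℝ (fderiv ℝ f) y (stdVec i) (stdVec i) := by
  refine Finset.sum_congr rfl fun i _ => ?_
  rw [iteratedFDeriv_two_apply]
  rfl

lemma hasDerivAt_kirchhoff (hu : ContDiff ℝ 3 (uncurry u))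
    (hsol : ∀ t x, tderiv2 u t x - lap (u t) x + u t x ^ 5 = 0) (t : ℝ) (x : E3) (τ : ℝ) :
    HasDerivAt (fun τ => kirchhoff (u τ) (tderiv u τ) (t - τ) x)
      (-((t - τ) * ∫ ω, u τ (x + (t - τ) • ω) ^ 5 ∂sphMeas)) τ := by
  set U := uncurry u with hU
  have hc1 : ContDiff ℝ 2 (fderiv ℝ U) := hu.fderiv_right (by norm_num)
  have hc2 : ContDiff ℝ 1 (fderiv ℝ (fderiv ℝ U)) := hc1.fderiv_right (by norm_num)
  have hd0 : Differentiable ℝ U := hu.differentiable (by norm_num)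
  have hd1 : Differentiable ℝ (fderiv ℝ U) := hc1.differentiable (by norm_num)
  have cU := hu.continuous
  have cU1 := hc1.continuous
  have cU2 := hc2.continuous
  set c : ℝ → E3 → ℝ × E3 := fun τ ω => (τ, x + (t - τ) • ω) with hc
  have cc : Continuous (uncurry c) := by simp only [hc, uncurry_def]; fun_prop
  have hcd : ∀ τ ω, HasDerivAt (c · ω) (1, -ω) τ := fun τ ω => by
    have h1 := ((((hasDerivAt_id τ).const_sub t).smul_const ω).const_add x)
    simpa [hc] using (hasDerivAt_id τ).prodMk h1
  set g : ℝ → E3 → ℝ := fun τ ω => (t - τ) * fderiv ℝ U (c τ ω) (1, 0) + U (c τ ω) +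
    (t - τ) * fderiv ℝ U (c τ ω) (0, ω) with hg
  set g' : ℝ → E3 → ℝ := fun τ ω =>
    (t - τ) * fderiv ℝ (fderiv ℝ U) (c τ ω) (1, 0) (1, 0) -
    ((t - τ) * fderiv ℝ (fderiv ℝ U) (c τ ω) (0, ω) (0, ω) +
      2 * fderiv ℝ U (c τ ω) (0, ω)) with hg'
  have cg : Continuous (uncurry g) := by
    have e1 : Continuous fun p : ℝ × E3 => fderiv ℝ U (c p.1 p.2) := cU1.comp cc
    have e2 : Continuous fun p : ℝ × E3 => U (c p.1 p.2) := cU.comp cc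
    simp only [hg, uncurry_def]
    fun_prop
  have cg' : Continuous (uncurry g') := by
    have e1 : Continuous fun p : ℝ × E3 => fderiv ℝ U (c p.1 p.2) := cU1.comp cc
    have e2 : Continuous fun p : ℝ × E3 => fderiv ℝ (fderiv ℝ U) (c p.1 p.2) := cU2.comp cc
    simp only [hg', uncurry_def]
    fun_prop
  have hgd : ∀ τ ω, HasDerivAt (g · ω) (g' τ ω) τ := by
    intro τ ω
    have a0 := (hd0 (c τ ω)).hasFDerivAt.comp_hasDerivAt τ (hcd τ ω)
    have a1 := (hd1 (c τ ω)).hasFDerivAt.comp_hasDerivAt τ (hcd τ ω)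
    have r1 := (hasDerivAt_id τ).const_sub t
    have a2 := a1.clm_apply (hasDerivAt_const τ ((1 : ℝ), (0 : E3)))
    have a3 := a1.clm_apply (hasDerivAt_const τ ((0 : ℝ), ω))
    refine (((r1.mul a2).add a0).add (r1.mul a3)).congr_deriv ?_
    have hsymm : fderiv ℝ (fderiv ℝ U) (c τ ω) (1, 0) (0, ω) =
        fderiv ℝ (fderiv ℝ U) (c τ ω) (0, ω) (1, 0) :=
      (hu.contDiffAt.isSymmSndFDerivAt (by simp; norm_num)) _ _
    have hv : ((1 : ℝ), -ω) = ((1 : ℝ), (0 : E3)) - ((0 : ℝ), ω) := by simp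
    simp only [hv, hg', map_sub, map_zero, _root_.sub_apply, comp_apply, id, hsymm, add_zero]
    ring
  have e0 : (fun τ => kirchhoff (u τ) (tderiv u τ) (t - τ) x) =
      fun τ => ∫ ω, g τ ω ∂sphMeas := by
    funext τ
    refine integral_congr_ae (ae_of_all _ fun ω => ?_)
    simp only [hg, hc, tderiv_eq hu, fderiv_slice_eq hu]
    rfl
  rw [e0]
  refine (hasDerivAt_integral_sphMeas cg cg' hgd τ).congr_deriv ?_
  have hslice : ContDiff ℝ 2 (u τ) :=
    (hu.of_le (by norm_num)).comp (contDiff_prodMk_right τ)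
  have hepd := integral_sphMeas_epd hslice x (t - τ)
  have cω : Continuous fun ω => c τ ω := cc.comp (by fun_prop : Continuous fun ω => (τ, ω))
  have q1 : Continuous fun ω => fderiv ℝ U (c τ ω) := cU1.comp cω
  have q2 : Continuous fun ω => fderiv ℝ (fderiv ℝ U) (c τ ω) := cU2.comp cω
  have i1 : Integrable (fun ω => (t - τ) * fderiv ℝ (fderiv ℝ U) (c τ ω) (1, 0) (1, 0)) sphMeas :=
    integrable_sphMeas (by fun_prop)
  have i2 : Integrable (fun ω => (t - τ) * fderiv ℝ (fderiv ℝ U) (c τ ω) (0, ω) (0, ω) +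
      2 * fderiv ℝ U (c τ ω) (0, ω)) sphMeas :=
    integrable_sphMeas (by fun_prop)
  have i3 : Integrable (fun ω => (t - τ) * ∑ i,
      fderiv ℝ (fderiv ℝ U) (c τ ω) (0, stdVec i) (0, stdVec i)) sphMeas :=
    integrable_sphMeas (by fun_prop)
  simp only [fderiv_fderiv_slice_eq hu, fderiv_slice_eq hu, smul_eq_mul] at hepd
  rw [← integral_const_mul] at hepd
  simp only [hg']
  rw [integral_sub i1 i2]
  refine (congrArg _ hepd).trans ?_
  refine (integral_sub i1 i3).symm.trans ?_
  rw [← integral_const_mul, ← integral_neg]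
  refine integral_congr_ae (ae_of_all _ fun ω => ?_)
  have h1 := hsol τ (x + (t - τ) • ω)
  rw [tderiv2_eq hu, lap_eq] at h1
  simp only [fderiv_fderiv_slice_eq hu] at h1
  simp only [hc]
  linear_combination (t - τ) * h1

lemma duh_eq_kirchhoff (hu : ContDiff ℝ 3 (uncurry u))
    (hsol : ∀ t x, tderiv2 u t x - lap (u t) x + u t x ^ 5 = 0) {s t : ℝ} (hs : 0 ≤ s)
    (hst : s < t) (x : E3) :
    4 * π * duh u 0 s t x =
      kirchhoff (u 0) (tderiv u 0) (t - 0) x - kirchhoff (u s) (tderiv u s) (t - s) x := by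
  have hcont : Continuous fun τ => -((t - τ) * ∫ ω, u τ (x + (t - τ) • ω) ^ 5 ∂sphMeas) := by
    have h0 : Continuous (uncurry fun (τ : ℝ) (ω : E3) => u τ (x + (t - τ) • ω) ^ 5) := by
      have : Continuous fun p : ℝ × E3 => uncurry u (p.1, x + (t - p.1) • p.2) :=
        hu.continuous.comp (by fun_prop)
      exact this.pow 5
    have := continuous_integral_sphMeas h0
    fun_prop
  have hftc := intervalIntegral.integral_eq_sub_of_hasDerivAt (a := 0) (b := s)
    (fun τ _ => hasDerivAt_kirchhoff hu hsol t x τ) (hcont.intervalIntegrable 0 s)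
  have h1 : 4 * π * duh u 0 s t x =
      ∫ τ in (0 : ℝ)..s, (t - τ) * ∫ ω, u τ (x + (t - τ) • ω) ^ 5 ∂sphMeas := by
    rw [duh, ← intervalIntegral.integral_const_mul]
    refine intervalIntegral.integral_congr fun τ hτ => ?_
    rw [uIcc_of_le hs] at hτ
    have hr : 0 < t - τ := by linarith [hτ.2]
    rw [sphInt_eq_integral_sphMeas x hr]
    have := pi_pos.ne'
    field_simp
  rw [intervalIntegral.integral_neg] at hftc
  rw [h1]
  linarith

end Duhamel


open scoped SchwartzMap LineDeriv in
lemma schwartzMap_eq_integral (F : 𝓢(E3, ℂ)) (y : E3) :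
    F y = ∫ ξ, Complex.exp (charForm ξ y) * 𝓕 F ξ := by
  have h : 𝓕⁻ (𝓕 F) = F := FourierTransform.fourierInv_fourier_eq F
  conv_lhs => rw [← h]
  rw [SchwartzMap.fourierInv_coe, Real.fourierInv_eq']
  refine integral_congr_ae (ae_of_all _ fun ξ => ?_)
  simp only [smul_eq_mul, charForm_apply, real_inner_comm]
  congr 2
  push_cast
  ring

open scoped SchwartzMap LineDeriv in
lemma fourier_lineDerivOp_apply (F : 𝓢(E3, ℂ)) (v ξ : E3) :
    𝓕 (∂_{v} F) ξ = charForm ξ v * 𝓕 F ξ := by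
  have hg : (inner ℝ · v : E3 → ℝ).HasTemperateGrowth := ((innerSL ℝ).flip v).hasTemperateGrowth
  rw [SchwartzMap.fourier_lineDerivOp_eq, smul_apply,
    SchwartzMap.smulLeftCLM_apply_apply hg, charForm_apply, real_inner_comm]
  simp [mul_assoc]

open scoped SchwartzMap LineDeriv in
lemma fderiv_schwartzMap_eq_integral (F : 𝓢(E3, ℂ)) (y v : E3) :
    fderiv ℝ F y v = ∫ ξ, Complex.exp (charForm ξ y) * (charForm ξ v * 𝓕 F ξ) := by
  rw [← SchwartzMap.lineDerivOp_apply_eq_fderiv, schwartzMap_eq_integral]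
  exact integral_congr_ae (ae_of_all _ fun ξ =>
    congrArg (_ * ·) (fourier_lineDerivOp_apply F v ξ))

open scoped SchwartzMap in
/-- The complex-valued Schwartz map attached to a real Schwartz function. -/
def IsSchwartz.toSchwartzMap {f : E3 → ℝ} (hf : IsSchwartz f) : 𝓢(E3, ℂ) :=
  SchwartzMap.postcompCLM Complex.ofRealCLM (⟨f, hf.1, hf.2⟩ : 𝓢(E3, ℝ))

@[simp]
lemma IsSchwartz.toSchwartzMap_apply {f : E3 → ℝ} (hf : IsSchwartz f) (x : E3) :
    hf.toSchwartzMap x = (f x : ℂ) := rfl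

lemma IsSchwartz.fderiv_toSchwartzMap {f : E3 → ℝ} (hf : IsSchwartz f) (y v : E3) :
    fderiv ℝ hf.toSchwartzMap y v = (fderiv ℝ f y v : ℂ) := by
  have h1 : HasFDerivAt f (fderiv ℝ f y) y :=
    (hf.1.differentiable (by simp) y).hasFDerivAt
  have h2 : HasFDerivAt hf.toSchwartzMap (Complex.ofRealCLM.comp (fderiv ℝ f y)) y :=
    Complex.ofRealCLM.hasFDerivAt.comp y h1
  rw [h2.fderiv]
  rfl

lemma norm_cexp_charForm (ξ y : E3) : ‖Complex.exp (charForm ξ y)‖ = 1 := by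
  rw [← fourierChar_eq_cexp]
  exact Circle.norm_coe _

lemma norm_charForm_le (ξ y : E3) : ‖charForm ξ y‖ ≤ 2 * π * (‖y‖ * ‖ξ‖) := by
  rw [charForm_apply]
  simp only [norm_mul, Complex.norm_I, Complex.norm_ofNat, Complex.norm_real, norm_eq_abs,
    abs_of_pos pi_pos, mul_one]
  gcongr
  exact abs_real_inner_le_norm y ξ

open scoped SchwartzMap in
lemma integrable_norm_mul_schwartzMap (F : 𝓢(E3, ℂ)) : Integrable fun ξ => ‖ξ‖ * ‖F ξ‖ := by
  simpa using F.integrable_pow_mul volume 1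

lemma continuous_charForm : Continuous charForm := by
  unfold charForm
  have : Continuous fun ξ : E3 => (innerSL ℝ ξ : E3 →L[ℝ] ℝ) := (innerSL ℝ).continuous
  have h2 : Continuous fun ξ : E3 => Complex.ofRealCLM.comp (innerSL ℝ ξ : E3 →L[ℝ] ℝ) :=
    continuous_const.clm_comp this
  exact h2.const_smul (2 * π * Complex.I : ℂ)

open scoped SchwartzMap in
/-- Kirchhoff's spherical means of Schwartz data, on the Fourier side. -/
lemma kirchhoff_eq_integral {f h : E3 → ℝ} (hf : IsSchwartz f) (hh : IsSchwartz h)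
    (r : ℝ) (x : E3) :
    (kirchhoff f h r x : ℂ) = ∫ ξ, Complex.exp (charForm ξ x) *
      ((∫ ω, r * Complex.exp (charForm ξ (r • ω)) ∂sphMeas) * 𝓕 hh.toSchwartzMap ξ +
        (∫ ω, Complex.exp (charForm ξ (r • ω)) * (1 + r * charForm ξ ω) ∂sphMeas) *
          𝓕 hf.toSchwartzMap ξ) := by
  set a := 𝓕 hf.toSchwartzMap with ha
  set b := 𝓕 hh.toSchwartzMap with hb
  have ia : Integrable a := a.integrable
  have ib : Integrable b := b.integrable
  have ca : Continuous a := a.continuous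
  have cb : Continuous b := b.continuous
  have cc := continuous_charForm
  set G : E3 → E3 → ℂ := fun ω ξ => Complex.exp (charForm ξ x) *
    (r * Complex.exp (charForm ξ (r • ω)) * b ξ +
      Complex.exp (charForm ξ (r • ω)) * (1 + r * charForm ξ ω) * a ξ) with hG
  have cG : Continuous (uncurry G) := by
    simp only [hG, uncurry_def]
    have c1 : Continuous fun p : E3 × E3 => charForm p.2 := cc.comp continuous_snd
    have c2 : Continuous fun p : E3 × E3 => a p.2 := ca.comp continuous_snd
    have c3 : Continuous fun p : E3 × E3 => b p.2 := cb.comp continuous_snd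
    fun_prop
  have hbd : Integrable fun ξ => |r| * ‖b ξ‖ + (‖a ξ‖ + |r| * (2 * π * (‖ξ‖ * ‖a ξ‖))) :=
    (ib.norm.const_mul _).add
      (ia.norm.add (((integrable_norm_mul_schwartzMap a).const_mul _).const_mul _))
  have iG : Integrable (uncurry G) (sphMeas.prod volume) := by
    have h1 : Integrable (fun p : E3 × E3 => (1 : ℝ) *
        (|r| * ‖b p.2‖ + (‖a p.2‖ + |r| * (2 * π * (‖p.2‖ * ‖a p.2‖)))))
        (sphMeas.prod volume) := (integrable_const (1 : ℝ)).mul_prod hbd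
    refine h1.mono' cG.aestronglyMeasurable ?_
    have e1 : ∀ᵐ p : E3 × E3 ∂(sphMeas.prod volume), ‖p.1‖ = 1 :=
      Measure.quasiMeasurePreserving_fst.ae ae_sphMeas_norm
    filter_upwards [e1] with p hp
    simp only [uncurry_def, hG, norm_mul, norm_cexp_charForm, one_mul]
    refine (norm_add_le _ _).trans ?_
    simp only [norm_mul, norm_cexp_charForm, one_mul, mul_one, Complex.norm_real, norm_eq_abs]
    gcongr
    calc ‖1 + r * charForm p.2 p.1‖ * ‖a p.2‖
        ≤ (1 + |r| * (2 * π * (‖p.1‖ * ‖p.2‖))) * ‖a p.2‖ := by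
          gcongr
          refine (norm_add_le _ _).trans ?_
          simp only [norm_mul, norm_one, Complex.norm_real, norm_eq_abs]
          gcongr
          exact norm_charForm_le _ _
      _ = _ := by rw [hp]; ring
  have h1 : ∀ ω, ((r * h (x + r • ω) + f (x + r • ω) + r * fderiv ℝ f (x + r • ω) ω : ℝ) : ℂ) =
      ∫ ξ, G ω ξ := by
    intro ω
    push_cast
    rw [← hh.toSchwartzMap_apply, ← hf.toSchwartzMap_apply, ← hf.fderiv_toSchwartzMap,
      schwartzMap_eq_integral, schwartzMap_eq_integral hf.toSchwartzMap,
      fderiv_schwartzMap_eq_integral, ← ha, ← hb, ← integral_const_mul, ← integral_const_mul]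
    have mb : ∀ (c : E3 → ℂ) (w : E3 → ℂ), Continuous w → Continuous c → (∀ ξ, ‖c ξ‖ = 1) →
        Integrable w → Integrable fun ξ => c ξ * w ξ := fun c w cw hc h1 hw =>
      hw.mono (by fun_prop) (ae_of_all _ fun ξ => by simp [h1])
    have j1 : Integrable fun ξ => Complex.exp (charForm ξ (x + r • ω)) * b ξ :=
      mb _ _ cb (by fun_prop) (fun ξ => norm_cexp_charForm _ _) ib
    have j2 : Integrable fun ξ => Complex.exp (charForm ξ (x + r • ω)) * a ξ :=
      mb _ _ ca (by fun_prop) (fun ξ => norm_cexp_charForm _ _) ia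
    have j3 : Integrable fun ξ => Complex.exp (charForm ξ (x + r • ω)) * (charForm ξ ω * a ξ) := by
      refine mb _ _ (by fun_prop) (by fun_prop) (fun ξ => norm_cexp_charForm _ _) ?_
      refine ((integrable_norm_mul_schwartzMap a).const_mul (2 * π * ‖ω‖)).mono' (by fun_prop)
        (ae_of_all _ fun ξ => ?_)
      rw [norm_mul]
      calc _ ≤ (2 * π * (‖ω‖ * ‖ξ‖)) * ‖a ξ‖ := by gcongr; exact norm_charForm_le _ _
        _ = _ := by ring
    rw [← integral_add (j1.const_mul _) j2]
    refine (integral_add ((j1.const_mul _).add j2) (j3.const_mul _)).symm.trans ?_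
    refine integral_congr_ae (ae_of_all _ fun ξ => ?_)
    simp only [hG, map_add, Complex.exp_add, Pi.add_apply]
    ring
  rw [kirchhoff, ← integral_complex_ofReal]
  simp only [h1]
  rw [integral_integral_swap iG]
  refine integral_congr_ae (ae_of_all _ fun ξ => ?_)
  simp only [hG]
  have k1 : Integrable (fun ω => (r : ℂ) * Complex.exp (charForm ξ (r • ω))) sphMeas :=
    integrable_sphMeas (by fun_prop)
  have k2 : Integrable (fun ω => Complex.exp (charForm ξ (r • ω)) * (1 + r * charForm ξ ω))
      sphMeas := integrable_sphMeas (by fun_prop)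
  rw [integral_const_mul, integral_add (k1.mul_const _) (k2.mul_const _), integral_mul_const,
    integral_mul_const]

lemma sq_lintegral_mul_le {α : Type*} [MeasurableSpace α] {μ : Measure α} {f g : α → ℝ≥0∞}
    (hf : AEMeasurable f μ) (hg : AEMeasurable g μ) :
    (∫⁻ x, f x * g x ∂μ) ^ 2 ≤ (∫⁻ x, f x ^ 2 ∂μ) * ∫⁻ x, g x ^ 2 ∂μ := by
  have h := ENNReal.lintegral_mul_le_Lp_mul_Lq μ
    (by rw [Real.holderConjugate_iff]; norm_num : (2 : ℝ).HolderConjugate 2) hf hg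
  simp only [ENNReal.rpow_ofNat, Pi.mul_apply] at h
  have h2 : ∀ z : ℝ≥0∞, (z ^ ((1 : ℝ) / 2)) ^ 2 = z := fun z => by
    rw [← ENNReal.rpow_ofNat, ← ENNReal.rpow_mul]; norm_num
  calc _ ≤ _ := pow_le_pow_left' h 2
    _ = _ := by rw [mul_pow, h2, h2]

open scoped SchwartzMap in
lemma integrable_inv_norm_mul (B : 𝓢(E3, ℂ))
    (hfin : ∫⁻ ξ, ‖ξ‖ₑ⁻¹ ^ 2 * ‖B ξ‖ₑ ^ 2 ≠ ∞) : Integrable fun ξ => ‖ξ‖⁻¹ * ‖B ξ‖ := by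
  have cB := B.continuous
  have hm : Measurable fun ξ : E3 => ‖ξ‖⁻¹ * ‖B ξ‖ := by fun_prop
  have i1 : Integrable fun ξ : E3 => (‖ξ‖⁻¹ * ‖B ξ‖) ^ 2 := by
    refine ⟨by fun_prop, ?_⟩
    rw [hasFiniteIntegral_iff_enorm, lt_top_iff_ne_top]
    refine ne_top_of_le_ne_top hfin (lintegral_mono_ae ?_)
    filter_upwards [Measure.ae_ne volume (0 : E3)] with ξ hξ
    rw [enorm_pow, enorm_mul, mul_pow, enorm_inv (by simpa using hξ), enorm_norm, enorm_norm]
  have i2 : Integrable fun ξ : E3 => (Metric.ball (0 : E3) 1).indicator (fun _ => (1 : ℝ)) ξ :=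
    (integrable_indicator_iff Metric.isOpen_ball.measurableSet).2
      (integrableOn_const (measure_ball_lt_top).ne)
  refine ((i1.add i2).add B.integrable.norm).mono' hm.aestronglyMeasurable
    (ae_of_all _ fun ξ => ?_)
  rw [norm_eq_abs, abs_of_nonneg (by positivity)]
  simp only [Pi.add_apply]
  by_cases h : ξ ∈ Metric.ball (0 : E3) 1
  · rw [indicator_of_mem h]
    nlinarith [norm_nonneg (B ξ), sq_nonneg (‖ξ‖⁻¹ * ‖B ξ‖ - 1),
      mul_nonneg (inv_nonneg.2 (norm_nonneg ξ)) (norm_nonneg (B ξ))]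
  · rw [indicator_of_notMem h]
    have h1 : (1 : ℝ) ≤ ‖ξ‖ := by simpa using h
    have h2 : ‖ξ‖⁻¹ ≤ 1 := inv_le_one_of_one_le₀ h1
    nlinarith [norm_nonneg (B ξ), sq_nonneg (‖ξ‖⁻¹ * ‖B ξ‖)]

lemma fourierChar_add_mul (s r n : ℝ) :
    (𝐞 (s + r * n) : ℂ) = 𝐞 s * ((cos (2 * π * n * r) : ℝ) + (sin (2 * π * n * r) : ℝ) * Complex.I) := by
  rw [Real.fourierChar_apply, Real.fourierChar_apply, Complex.ofReal_cos, Complex.ofReal_sin,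
    ← Complex.exp_mul_I, ← Complex.exp_add]
  congr 1
  push_cast
  ring

section Kirchhoff

variable {f h : E3 → ℝ}

/-- Amplitude of the half-waves generated by the initial position. -/
def posAmp (hf : IsSchwartz f) (ξ : E3) : ℂ :=
  (sphMeas.real univ / 2 : ℝ) * 𝓕 hf.toSchwartzMap ξ

/-- Amplitude of the half-waves generated by the initial velocity. -/
def velAmp (hh : IsSchwartz h) (ξ : E3) : ℂ :=
  (sphMeas.real univ / (4 * π * ‖ξ‖) : ℝ) * -Complex.I * 𝓕 hh.toSchwartzMap ξ

lemma integrable_posAmp (hf : IsSchwartz f) : Integrable (posAmp hf) :=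
  (𝓕 hf.toSchwartzMap).integrable.const_mul _

lemma measurable_posAmp (hf : IsSchwartz f) : Measurable (posAmp hf) :=
  (𝓕 hf.toSchwartzMap).continuous.measurable.const_mul _

lemma measurable_velAmp (hh : IsSchwartz h) : Measurable (velAmp hh) := by
  have := (𝓕 hh.toSchwartzMap).continuous.measurable
  unfold velAmp
  fun_prop

lemma integrable_velAmp (hh : IsSchwartz h)
    (hfin : ∫⁻ ξ, ‖ξ‖ₑ⁻¹ ^ 2 * ‖𝓕 hh.toSchwartzMap ξ‖ₑ ^ 2 ≠ ∞) : Integrable (velAmp hh) := by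
  refine ((integrable_inv_norm_mul _ hfin).const_mul (sphMeas.real univ / (4 * π))).mono'
    (measurable_velAmp hh).aestronglyMeasurable (ae_of_all _ fun ξ => le_of_eq ?_)
  have hm : 0 ≤ sphMeas.real univ := measureReal_nonneg
  have := pi_pos
  simp only [velAmp, norm_mul, Complex.norm_real, norm_neg, Complex.norm_I, mul_one, norm_eq_abs]
  rw [abs_of_nonneg (by positivity)]
  ring

lemma halfWave_eq (a : E3 → ℂ) (t : ℝ) (x : E3) :
    halfWave a t x = ∫ ξ, (𝐞 (inner ℝ x ξ + t * ‖ξ‖) : ℂ) * a ξ := rfl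

lemma integrable_halfWave {a : E3 → ℂ} (ha : Integrable a) (t : ℝ) (x : E3) :
    Integrable fun ξ => (𝐞 (inner ℝ x ξ + t * ‖ξ‖) : ℂ) * a ξ := by
  have hc : Continuous fun ξ : E3 => (𝐞 (inner ℝ x ξ + t * ‖ξ‖) : ℂ) :=
    continuous_subtype_val.comp (Real.continuous_fourierChar.comp (by fun_prop))
  exact ha.mono (hc.aestronglyMeasurable.mul ha.1)
    (ae_of_all _ fun ξ => by rw [norm_mul, norm_fourierChar, one_mul])

lemma kirchhoff_eq_halfWave (hf : IsSchwartz f) (hh : IsSchwartz h)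
    (hfin : ∫⁻ ξ, ‖ξ‖ₑ⁻¹ ^ 2 * ‖𝓕 hh.toSchwartzMap ξ‖ₑ ^ 2 ≠ ∞) (r : ℝ) (x : E3) :
    (kirchhoff f h r x : ℂ) = halfWave (posAmp hf) r x + halfWave (posAmp hf) (-r) x +
      (halfWave (velAmp hh) r x - halfWave (velAmp hh) (-r) x) := by
  have ip := integrable_posAmp hf
  have iv := integrable_velAmp hh hfin
  rw [kirchhoff_eq_integral hf hh]
  simp only [halfWave_eq]
  rw [← integral_add (integrable_halfWave ip r x) (integrable_halfWave ip (-r) x),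
    ← integral_sub (integrable_halfWave iv r x) (integrable_halfWave iv (-r) x)]
  refine Eq.trans ?_ (integral_add ((integrable_halfWave ip r x).add (integrable_halfWave ip (-r) x))
    ((integrable_halfWave iv r x).sub (integrable_halfWave iv (-r) x)))
  refine integral_congr_ae ?_
  filter_upwards [Measure.ae_ne volume (0 : E3)] with ξ hξ
  obtain ⟨h1, h2⟩ := integral_sphMeas_char ξ r
  have hn : (‖ξ‖ : ℂ) ≠ 0 := by simpa using hξ
  have hπ : (π : ℂ) ≠ 0 := by simp
  have hk : ((2 * π * ‖ξ‖ : ℝ) : ℂ) ≠ 0 := by push_cast; simp [hn]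
  rw [h1, (eq_div_iff hk).2 ((mul_comm _ _).trans h2), ← fourierChar_eq_cexp ξ x]
  simp only [fourierChar_add_mul]
  simp only [posAmp, velAmp, mul_neg, cos_neg, sin_neg]
  push_cast
  field_simp
  ring_nf
  simp only [Complex.I_sq]
  ring

lemma lintegral_halfWave_neg_pow_four_le {a : E3 → ℂ} (ham : Measurable a) (ha : Integrable a) :
    ∫⁻ y : ℝ × E3, ‖halfWave a (-y.1) y.2‖ₑ ^ 4 ≤
      ENNReal.ofReal (4 * π) * (∫⁻ ξ, ‖a ξ‖ₑ ^ 2 * ‖ξ‖ₑ) ^ 2 := by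
  refine le_trans (le_of_eq ?_) (lintegral_halfWave_pow_four_le ham ha)
  have hmp : MeasurePreserving (Prod.map Neg.neg id : ℝ × E3 → ℝ × E3) :=
    (Measure.measurePreserving_neg (volume : Measure ℝ)).prod (MeasurePreserving.id volume)
  have hc := continuous_halfWave ha
  exact hmp.lintegral_comp (f := fun y : ℝ × E3 => ‖halfWave a y.1 y.2‖ₑ ^ 4)
    (hc.measurable.enorm.pow_const 4)

lemma lintegral_posAmp_sq_le (hf : IsSchwartz f) :
    (∫⁻ ξ, ‖posAmp hf ξ‖ₑ ^ 2 * ‖ξ‖ₑ) ^ 2 ≤ sphMeas univ ^ 4 *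
      ((∫⁻ ξ, ‖𝓕 hf.toSchwartzMap ξ‖ₑ ^ 2) * ∫⁻ ξ, ‖ξ‖ₑ ^ 2 * ‖𝓕 hf.toSchwartzMap ξ‖ₑ ^ 2) := by
  have hB : Measurable fun ξ => 𝓕 hf.toSchwartzMap ξ :=
    (𝓕 hf.toSchwartzMap).continuous.measurable
  set B := 𝓕 hf.toSchwartzMap with hBdef
  have h1 : ∀ ξ, ‖posAmp hf ξ‖ₑ ≤ sphMeas univ * ‖B ξ‖ₑ := fun ξ => by
    rw [posAmp, enorm_mul]
    gcongr
    rw [← ofReal_norm, Complex.norm_real, norm_eq_abs, abs_of_nonneg (by positivity),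
      ← ENNReal.ofReal_toReal (measure_ne_top sphMeas univ)]
    apply ENNReal.ofReal_le_ofReal
    have : 0 ≤ sphMeas.real univ := measureReal_nonneg
    change sphMeas.real univ / 2 ≤ sphMeas.real univ
    linarith
  calc _ ≤ (∫⁻ ξ, sphMeas univ ^ 2 * (‖B ξ‖ₑ * (‖ξ‖ₑ * ‖B ξ‖ₑ))) ^ 2 := by
        refine pow_le_pow_left' (lintegral_mono fun ξ => ?_) 2
        calc _ ≤ (sphMeas univ * ‖B ξ‖ₑ) ^ 2 * ‖ξ‖ₑ := by gcongr; exact h1 ξ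
          _ = _ := by ring
    _ = sphMeas univ ^ 4 * (∫⁻ ξ, ‖B ξ‖ₑ * (‖ξ‖ₑ * ‖B ξ‖ₑ)) ^ 2 := by
        rw [lintegral_const_mul _ (by fun_prop)]; ring
    _ ≤ _ := by
        gcongr
        refine (sq_lintegral_mul_le (by fun_prop) (by fun_prop)).trans_eq ?_
        simp only [mul_pow]

lemma lintegral_velAmp_sq_le (hh : IsSchwartz h) :
    (∫⁻ ξ, ‖velAmp hh ξ‖ₑ ^ 2 * ‖ξ‖ₑ) ^ 2 ≤ sphMeas univ ^ 4 *
      ((∫⁻ ξ, ‖ξ‖ₑ⁻¹ ^ 2 * ‖𝓕 hh.toSchwartzMap ξ‖ₑ ^ 2) *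
        ∫⁻ ξ, ‖𝓕 hh.toSchwartzMap ξ‖ₑ ^ 2) := by
  have hB : Measurable fun ξ => 𝓕 hh.toSchwartzMap ξ :=
    (𝓕 hh.toSchwartzMap).continuous.measurable
  set B := 𝓕 hh.toSchwartzMap with hBdef
  have h1 : ∀ ξ, ξ ≠ 0 → ‖velAmp hh ξ‖ₑ ≤ sphMeas univ * ‖ξ‖ₑ⁻¹ * ‖B ξ‖ₑ := fun ξ hξ => by
    have hn : ‖ξ‖ ≠ 0 := by simpa using hξ
    have hn' : 0 < ‖ξ‖ := by simpa using hξ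
    rw [velAmp, enorm_mul]
    gcongr
    rw [← enorm_norm ξ, ← enorm_inv hn, ← ofReal_norm, ← ofReal_norm,
      ← ENNReal.ofReal_toReal (measure_ne_top sphMeas univ),
      ← ENNReal.ofReal_mul (ENNReal.toReal_nonneg)]
    apply ENNReal.ofReal_le_ofReal
    have hm : 0 ≤ sphMeas.real univ := measureReal_nonneg
    change _ ≤ sphMeas.real univ * _
    have := pi_gt_three
    simp only [norm_mul, Complex.norm_real, norm_neg, Complex.norm_I, mul_one, norm_eq_abs,
      norm_inv, abs_norm]
    rw [abs_of_nonneg (by positivity), div_eq_mul_inv]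
    gcongr
    nlinarith
  calc _ ≤ (∫⁻ ξ, sphMeas univ ^ 2 * (‖ξ‖ₑ⁻¹ * ‖B ξ‖ₑ * ‖B ξ‖ₑ)) ^ 2 := by
        refine pow_le_pow_left' (lintegral_mono_ae ?_) 2
        filter_upwards [Measure.ae_ne volume (0 : E3)] with ξ hξ
        have hi : ‖ξ‖ₑ⁻¹ * ‖ξ‖ₑ = 1 := ENNReal.inv_mul_cancel (by simpa using hξ) enorm_ne_top
        calc _ ≤ (sphMeas univ * ‖ξ‖ₑ⁻¹ * ‖B ξ‖ₑ) ^ 2 * ‖ξ‖ₑ := by gcongr; exact h1 ξ hξ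
          _ = sphMeas univ ^ 2 * (‖ξ‖ₑ⁻¹ * ‖B ξ‖ₑ * ‖B ξ‖ₑ) * (‖ξ‖ₑ⁻¹ * ‖ξ‖ₑ) := by ring
          _ = _ := by rw [hi, mul_one]
    _ = sphMeas univ ^ 4 * (∫⁻ ξ, ‖ξ‖ₑ⁻¹ * ‖B ξ‖ₑ * ‖B ξ‖ₑ) ^ 2 := by
        rw [lintegral_const_mul _ (by fun_prop)]; ring
    _ ≤ _ := by
        gcongr
        refine (sq_lintegral_mul_le (by fun_prop) (by fun_prop)).trans_eq ?_
        simp only [mul_pow]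

lemma add_pow_four_le (a b : ℝ≥0∞) : (a + b) ^ 4 ≤ 8 * (a ^ 4 + b ^ 4) := by
  have h := ENNReal.rpow_add_le_mul_rpow_add_rpow a b (p := 4) (by norm_num)
  have h3 : (4 : ℝ) - 1 = 3 := by norm_num
  simp only [h3, ENNReal.rpow_ofNat] at h
  norm_num at h
  exact h

lemma lintegral_const_mul_add_four {α : Type*} [MeasurableSpace α] {μ : Measure α} (c : ℝ≥0∞)
    {g₁ g₂ g₃ g₄ : α → ℝ≥0∞} (h₁ : Measurable g₁) (h₂ : Measurable g₂) (h₃ : Measurable g₃)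
    (h₄ : Measurable g₄) :
    ∫⁻ y, c * ((g₁ y + g₂ y) + (g₃ y + g₄ y)) ∂μ =
      c * ((∫⁻ y, g₁ y ∂μ + ∫⁻ y, g₂ y ∂μ) + (∫⁻ y, g₃ y ∂μ + ∫⁻ y, g₄ y ∂μ)) := by
  rw [lintegral_const_mul _ (by fun_prop), lintegral_add_left (by fun_prop),
    lintegral_add_left h₁, lintegral_add_left h₃]

lemma lintegral_kirchhoff_pow_four_le (hf : IsSchwartz f) (hh : IsSchwartz h)
    (hfin : ∫⁻ ξ, ‖ξ‖ₑ⁻¹ ^ 2 * ‖𝓕 hh.toSchwartzMap ξ‖ₑ ^ 2 ≠ ∞) :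
    ∫⁻ y : ℝ × E3, ‖kirchhoff f h y.1 y.2‖ₑ ^ 4 ≤
      128 * ENNReal.ofReal (4 * π) * sphMeas univ ^ 4 *
      ((∫⁻ ξ, ‖𝓕 hf.toSchwartzMap ξ‖ₑ ^ 2) * (∫⁻ ξ, ‖ξ‖ₑ ^ 2 * ‖𝓕 hf.toSchwartzMap ξ‖ₑ ^ 2) +
        (∫⁻ ξ, ‖ξ‖ₑ⁻¹ ^ 2 * ‖𝓕 hh.toSchwartzMap ξ‖ₑ ^ 2) *
          ∫⁻ ξ, ‖𝓕 hh.toSchwartzMap ξ‖ₑ ^ 2) := by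
  have ip := integrable_posAmp hf
  have iv := integrable_velAmp hh hfin
  have cp := continuous_halfWave ip
  have cv := continuous_halfWave iv
  have cp' : Continuous fun y : ℝ × E3 => halfWave (posAmp hf) (-y.1) y.2 :=
    cp.comp (by fun_prop : Continuous fun y : ℝ × E3 => (-y.1, y.2))
  have cv' : Continuous fun y : ℝ × E3 => halfWave (velAmp hh) (-y.1) y.2 :=
    cv.comp (by fun_prop : Continuous fun y : ℝ × E3 => (-y.1, y.2))
  have hpt : ∀ y : ℝ × E3, ‖kirchhoff f h y.1 y.2‖ₑ ^ 4 ≤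
      64 * ((‖halfWave (posAmp hf) y.1 y.2‖ₑ ^ 4 + ‖halfWave (posAmp hf) (-y.1) y.2‖ₑ ^ 4) +
        (‖halfWave (velAmp hh) y.1 y.2‖ₑ ^ 4 + ‖halfWave (velAmp hh) (-y.1) y.2‖ₑ ^ 4)) := by
    intro y
    have e : ‖kirchhoff f h y.1 y.2‖ₑ = ‖(kirchhoff f h y.1 y.2 : ℂ)‖ₑ := by
      rw [← ofReal_norm, ← ofReal_norm, Complex.norm_real]
    rw [e, kirchhoff_eq_halfWave hf hh hfin]
    calc _ ≤ ((‖halfWave (posAmp hf) y.1 y.2‖ₑ + ‖halfWave (posAmp hf) (-y.1) y.2‖ₑ) +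
        (‖halfWave (velAmp hh) y.1 y.2‖ₑ + ‖halfWave (velAmp hh) (-y.1) y.2‖ₑ)) ^ 4 := by
          gcongr
          exact (enorm_add_le _ _).trans (add_le_add (enorm_add_le _ _) (enorm_sub_le))
      _ ≤ 8 * ((‖halfWave (posAmp hf) y.1 y.2‖ₑ + ‖halfWave (posAmp hf) (-y.1) y.2‖ₑ) ^ 4 +
        (‖halfWave (velAmp hh) y.1 y.2‖ₑ + ‖halfWave (velAmp hh) (-y.1) y.2‖ₑ) ^ 4) :=
          add_pow_four_le _ _
      _ ≤ 8 * (8 * (‖halfWave (posAmp hf) y.1 y.2‖ₑ ^ 4 + ‖halfWave (posAmp hf) (-y.1) y.2‖ₑ ^ 4) +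
        8 * (‖halfWave (velAmp hh) y.1 y.2‖ₑ ^ 4 + ‖halfWave (velAmp hh) (-y.1) y.2‖ₑ ^ 4)) := by
          gcongr <;> exact add_pow_four_le _ _
      _ = _ := by ring
  have k1 := lintegral_halfWave_pow_four_le (measurable_posAmp hf) ip
  have k2 := lintegral_halfWave_neg_pow_four_le (measurable_posAmp hf) ip
  have k3 := lintegral_halfWave_pow_four_le (measurable_velAmp hh) iv
  have k4 := lintegral_halfWave_neg_pow_four_le (measurable_velAmp hh) iv
  have m1 := cp.measurable.enorm.pow_const 4
  have m2 := cp'.measurable.enorm.pow_const 4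
  have m3 := cv.measurable.enorm.pow_const 4
  have m4 := cv'.measurable.enorm.pow_const 4
  refine (lintegral_mono hpt).trans ?_
  rw [lintegral_const_mul_add_four 64 m1 m2 m3 m4]
  have l1 := lintegral_posAmp_sq_le hf
  have l2 := lintegral_velAmp_sq_le hh
  calc _ ≤ _ := by
        have hmul : ∀ {z w : ℝ≥0∞}, z ≤ w → ENNReal.ofReal (4 * π) * z ≤ ENNReal.ofReal (4 * π) * w :=
          fun hzw => by gcongr
        exact mul_le_mul_right (add_le_add
          (add_le_add (k1.trans (hmul l1)) (k2.trans (hmul l1)))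
          (add_le_add (k3.trans (hmul l2)) (k4.trans (hmul l2)))) _
    _ = _ := by ring

end Kirchhoff

section Plancherel

open scoped SchwartzMap

lemma integrable_norm_sq_schwartzMap (F : 𝓢(E3, ℂ)) : Integrable fun x => ‖F x‖ ^ 2 :=
  (F.memLp ((2 : ℕ) : ℝ≥0∞)).integrable_norm_pow (by norm_num)

lemma lintegral_enorm_sq_schwartzMap (F : 𝓢(E3, ℂ)) :
    ∫⁻ x, ‖F x‖ₑ ^ 2 = ENNReal.ofReal (∫ x, ‖F x‖ ^ 2) := by
  rw [ofReal_integral_eq_lintegral_ofReal (integrable_norm_sq_schwartzMap F)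
    (ae_of_all _ fun x => by positivity)]
  refine lintegral_congr fun x => ?_
  rw [ENNReal.ofReal_pow (norm_nonneg _), ofReal_norm]

lemma lintegral_enorm_sq_fourier (F : 𝓢(E3, ℂ)) :
    ∫⁻ ξ, ‖𝓕 F ξ‖ₑ ^ 2 = ENNReal.ofReal (∫ x, ‖F x‖ ^ 2) := by
  rw [lintegral_enorm_sq_schwartzMap, SchwartzMap.integral_norm_sq_fourier]

lemma gradient_apply_eq (f : E3 → ℝ) (x : E3) (i : Fin 3) :
    (gradient f x) i = fderiv ℝ f x (stdVec i) := by
  rw [← inner_gradient_left, EuclideanSpace.inner_single_right]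
  simp

open scoped LineDeriv in
lemma integrable_norm_gradient_sq {f : E3 → ℝ} (hf : IsSchwartz f) :
    Integrable fun x => ‖gradient f x‖ ^ 2 := by
  simp only [EuclideanSpace.real_norm_sq_eq, gradient_apply_eq]
  refine integrable_finsetSum _ fun i _ => ?_
  refine (integrable_norm_sq_schwartzMap (∂_{stdVec i} hf.toSchwartzMap)).congr
    (ae_of_all _ fun x => ?_)
  simp only [SchwartzMap.lineDerivOp_apply_eq_fderiv, hf.fderiv_toSchwartzMap, Complex.norm_real,
    norm_eq_abs, sq_abs]

open scoped LineDeriv in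
lemma lintegral_norm_sq_mul_fourier_le {f : E3 → ℝ} (hf : IsSchwartz f) :
    ∫⁻ ξ, ‖ξ‖ₑ ^ 2 * ‖𝓕 hf.toSchwartzMap ξ‖ₑ ^ 2 ≤
      ENNReal.ofReal (∫ x, ‖gradient f x‖ ^ 2) := by
  have hD : ∀ i : Fin 3, ∫⁻ ξ, ‖charForm ξ (stdVec i) * 𝓕 hf.toSchwartzMap ξ‖ₑ ^ 2 =
      ENNReal.ofReal (∫ x, fderiv ℝ f x (stdVec i) ^ 2) := fun i => by
    have h := lintegral_enorm_sq_fourier (∂_{stdVec i} hf.toSchwartzMap)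
    simp only [fourier_lineDerivOp_apply] at h
    rw [h]
    congr 1
    refine integral_congr_ae (ae_of_all _ fun x => ?_)
    simp only [SchwartzMap.lineDerivOp_apply_eq_fderiv, hf.fderiv_toSchwartzMap,
      Complex.norm_real, norm_eq_abs, sq_abs]
  have hI : ∀ i : Fin 3, Integrable fun x => fderiv ℝ f x (stdVec i) ^ 2 := fun i =>
    (integrable_norm_sq_schwartzMap (∂_{stdVec i} hf.toSchwartzMap)).congr
      (ae_of_all _ fun x => by
        simp only [SchwartzMap.lineDerivOp_apply_eq_fderiv, hf.fderiv_toSchwartzMap,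
          Complex.norm_real, norm_eq_abs, sq_abs])
  have hm : Measurable fun ξ => 𝓕 hf.toSchwartzMap ξ :=
    (𝓕 hf.toSchwartzMap).continuous.measurable
  have hc := continuous_charForm
  have hcm : ∀ i : Fin 3, Measurable fun ξ => charForm ξ (stdVec i) := fun i =>
    (hc.clm_apply continuous_const).measurable
  calc _ ≤ ∫⁻ ξ, ∑ i, ‖charForm ξ (stdVec i) * 𝓕 hf.toSchwartzMap ξ‖ₑ ^ 2 := by
        refine lintegral_mono fun ξ => ?_
        simp only [enorm_mul, mul_pow, ← Finset.sum_mul]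
        gcongr
        have e : ∀ i : Fin 3, ‖charForm ξ (stdVec i)‖ₑ ^ 2 =
            ENNReal.ofReal ((2 * π) ^ 2 * ξ i ^ 2) := fun i => by
          rw [← ofReal_norm, ← ENNReal.ofReal_pow (norm_nonneg _), charForm_apply,
            EuclideanSpace.inner_single_left]
          simp only [norm_mul, Complex.norm_I, Complex.norm_ofNat, Complex.norm_real, norm_eq_abs,
            abs_of_pos pi_pos, mul_one, map_one, one_mul, mul_pow, sq_abs]
        simp only [e]
        rw [← ENNReal.ofReal_sum_of_nonneg fun i _ => by positivity, ← Finset.mul_sum,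
          ← EuclideanSpace.real_norm_sq_eq, ← ofReal_norm, ← ENNReal.ofReal_pow (norm_nonneg _)]
        apply ENNReal.ofReal_le_ofReal
        have : 1 ≤ (2 * π) ^ 2 := by nlinarith [pi_gt_three]
        nlinarith [sq_nonneg ‖ξ‖]
    _ = ENNReal.ofReal (∫ x, ‖gradient f x‖ ^ 2) := by
        have hmi : ∀ i, Measurable fun ξ => ‖charForm ξ (stdVec i) * 𝓕 hf.toSchwartzMap ξ‖ₑ ^ 2 :=
          fun i => ((hcm i).mul hm).enorm.pow_const 2
        rw [lintegral_finsetSum _ fun i _ => hmi i]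
        simp only [hD, EuclideanSpace.real_norm_sq_eq, gradient_apply_eq]
        rw [← ENNReal.ofReal_sum_of_nonneg fun i _ => integral_nonneg fun x => by positivity,
          integral_finsetSum _ fun i _ => hI i]

end Plancherel

section Energy

variable {u : ℝ → E3 → ℝ} {t E A : ℝ}

lemma energy_bounds (h0 : IsSchwartz (u t)) (h1 : IsSchwartz (tderiv u t)) (hE : energy u t ≤ E) :
    ∫ x, tderiv u t x ^ 2 ≤ 2 * E ∧ ∫ x, ‖gradient (u t) x‖ ^ 2 ≤ 2 * E := by
  have i1 : Integrable fun x => tderiv u t x ^ 2 :=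
    (integrable_norm_sq_schwartzMap h1.toSchwartzMap).congr (ae_of_all _ fun x => by simp)
  have i2 := integrable_norm_gradient_sq h0
  have i3 : Integrable fun x => u t x ^ 6 := by
    have h6 : Integrable fun x => ‖h0.toSchwartzMap x‖ ^ 6 :=
      (h0.toSchwartzMap.memLp ((6 : ℕ) : ℝ≥0∞)).integrable_norm_pow (by norm_num)
    refine h6.congr (ae_of_all _ fun x => ?_)
    simp only [h0.toSchwartzMap_apply, Complex.norm_real, norm_eq_abs,
      Even.pow_abs (by decide : Even 6)]
  have j1 : Integrable fun x => 1 / 2 * tderiv u t x ^ 2 := i1.const_mul _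
  have j2 : Integrable fun x => 1 / 2 * ‖gradient (u t) x‖ ^ 2 := i2.const_mul _
  have j3 : Integrable fun x => 1 / 6 * u t x ^ 6 := i3.const_mul _
  have j12 : Integrable fun x => 1 / 2 * tderiv u t x ^ 2 + 1 / 2 * ‖gradient (u t) x‖ ^ 2 :=
    j1.add j2
  have e : energy u t = 1 / 2 * (∫ x, tderiv u t x ^ 2) +
      1 / 2 * (∫ x, ‖gradient (u t) x‖ ^ 2) + 1 / 6 * (∫ x, u t x ^ 6) := by
    rw [energy, integral_add j12 j3, integral_add j1 j2]
    simp only [integral_const_mul]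
  have p1 : 0 ≤ ∫ x, tderiv u t x ^ 2 := integral_nonneg fun x => by positivity
  have p2 : 0 ≤ ∫ x, ‖gradient (u t) x‖ ^ 2 := integral_nonneg fun x => by positivity
  have p3 : 0 ≤ ∫ x, u t x ^ 6 := integral_nonneg fun x => by positivity
  constructor <;> linarith

lemma sq_rpow_half (z : ℝ≥0∞) : (z ^ ((1 : ℝ) / 2)) ^ 2 = z := by
  rw [← ENNReal.rpow_ofNat, ← ENNReal.rpow_mul]; norm_num

lemma lintegral_fourier_sq_le (h0 : IsSchwartz (u t)) (hA : xNorm 2 (u t) ≤ ENNReal.ofReal A) :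
    ∫⁻ ξ, ‖𝓕 h0.toSchwartzMap ξ‖ₑ ^ 2 ≤ ENNReal.ofReal A ^ 2 := by
  rw [lintegral_enorm_sq_fourier, ← lintegral_enorm_sq_schwartzMap]
  refine le_trans (le_of_eq ?_) (pow_le_pow_left' hA 2)
  rw [xNorm, sq_rpow_half]
  refine lintegral_congr fun x => ?_
  rw [ENNReal.rpow_ofNat, h0.toSchwartzMap_apply, ← enorm_eq_nnnorm, ← ofReal_norm,
    ← ofReal_norm, Complex.norm_real]

lemma lintegral_inv_fourier_sq_le (h1 : IsSchwartz (tderiv u t))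
    (hA : sobNorm (-1) (tderiv u t) ≤ ENNReal.ofReal A) :
    ∫⁻ ξ, ‖ξ‖ₑ⁻¹ ^ 2 * ‖𝓕 h1.toSchwartzMap ξ‖ₑ ^ 2 ≤ ENNReal.ofReal A ^ 2 := by
  refine le_trans (le_of_eq ?_) (pow_le_pow_left' hA 2)
  rw [sobNorm, sq_rpow_half]
  refine lintegral_congr fun ξ => ?_
  rw [ENNReal.rpow_ofNat, mul_neg, mul_one, ENNReal.rpow_neg, ENNReal.rpow_ofNat, ENNReal.inv_pow]
  rfl

lemma continuous_kirchhoff {f h : E3 → ℝ} (hf : IsSchwartz f) (hh : IsSchwartz h)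
    (hfin : ∫⁻ ξ, ‖ξ‖ₑ⁻¹ ^ 2 * ‖𝓕 hh.toSchwartzMap ξ‖ₑ ^ 2 ≠ ∞) :
    Continuous fun y : ℝ × E3 => kirchhoff f h y.1 y.2 := by
  have cp := continuous_halfWave (integrable_posAmp hf)
  have cv := continuous_halfWave (integrable_velAmp hh hfin)
  have cp' : Continuous fun y : ℝ × E3 => halfWave (posAmp hf) (-y.1) y.2 :=
    cp.comp (by fun_prop : Continuous fun y : ℝ × E3 => (-y.1, y.2))
  have cv' : Continuous fun y : ℝ × E3 => halfWave (velAmp hh) (-y.1) y.2 :=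
    cv.comp (by fun_prop : Continuous fun y : ℝ × E3 => (-y.1, y.2))
  have h2 := Complex.continuous_re.comp ((cp.add cp').add (cv.sub cv'))
  refine h2.congr fun y => ?_
  have := congrArg Complex.re (kirchhoff_eq_halfWave hf hh hfin y.1 y.2)
  simpa using this.symm

/-- The constant in the space-time bound for the linear evolution of data with energy and
low-frequency bounds. -/
def kirchhoffConst : ℝ≥0∞ := 512 * ENNReal.ofReal (4 * π) * sphMeas univ ^ 4

lemma kirchhoffConst_ne_top : kirchhoffConst ≠ ∞ :=
  ENNReal.mul_ne_top (ENNReal.mul_ne_top (by norm_num) ENNReal.ofReal_ne_top)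
    (ENNReal.pow_ne_top (measure_ne_top _ _))

lemma lintegral_kirchhoff_le (h0 : IsSchwartz (u t)) (h1 : IsSchwartz (tderiv u t))
    (hE : energy u t ≤ E) (hA0 : xNorm 2 (u t) ≤ ENNReal.ofReal A)
    (hA1 : sobNorm (-1) (tderiv u t) ≤ ENNReal.ofReal A) :
    ∫⁻ y : ℝ × E3, ‖kirchhoff (u t) (tderiv u t) y.1 y.2‖ₑ ^ 4 ≤
      kirchhoffConst * (ENNReal.ofReal A ^ 2 * ENNReal.ofReal E) := by
  have b1 := lintegral_fourier_sq_le h0 hA0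
  have b2 := lintegral_inv_fourier_sq_le h1 hA1
  obtain ⟨e1, e2⟩ := energy_bounds h0 h1 hE
  have h2E : ENNReal.ofReal (2 * E) = 2 * ENNReal.ofReal E := by
    rw [ENNReal.ofReal_mul (by norm_num)]; norm_num
  have b3 : ∫⁻ ξ, ‖ξ‖ₑ ^ 2 * ‖𝓕 h0.toSchwartzMap ξ‖ₑ ^ 2 ≤ 2 * ENNReal.ofReal E :=
    (lintegral_norm_sq_mul_fourier_le h0).trans ((ENNReal.ofReal_le_ofReal e2).trans_eq h2E)
  have b4 : ∫⁻ ξ, ‖𝓕 h1.toSchwartzMap ξ‖ₑ ^ 2 ≤ 2 * ENNReal.ofReal E := by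
    rw [lintegral_enorm_sq_fourier, ← h2E]
    refine ENNReal.ofReal_le_ofReal (le_trans (le_of_eq ?_) e1)
    simp
  have hfin := ne_top_of_le_ne_top (ENNReal.pow_ne_top ENNReal.ofReal_ne_top) b2
  refine (lintegral_kirchhoff_pow_four_le h0 h1 hfin).trans ?_
  calc _ ≤ 128 * ENNReal.ofReal (4 * π) * sphMeas univ ^ 4 *
        (ENNReal.ofReal A ^ 2 * (2 * ENNReal.ofReal E) +
          ENNReal.ofReal A ^ 2 * (2 * ENNReal.ofReal E)) := by
        exact mul_le_mul_right (add_le_add (mul_le_mul' b1 b3) (mul_le_mul' b2 b4)) _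
    _ = _ := by rw [kirchhoffConst]; ring

end Energy

lemma lintegral_enorm_shift_pow_four {w : ℝ → E3 → ℝ}
    (hw : Measurable fun y : ℝ × E3 => ‖w y.1 y.2‖ₑ ^ 4) (c : ℝ) :
    ∫⁻ t, ∫⁻ x, ‖w (t - c) x‖ₑ ^ 4 = ∫⁻ y : ℝ × E3, ‖w y.1 y.2‖ₑ ^ 4 := by
  rw [lintegral_sub_right_eq_self (fun t => ∫⁻ x, ‖w t x‖ₑ ^ 4) c, Measure.volume_eq_prod,
    lintegral_prod _ hw.aemeasurable]

lemma measurable_enorm_shift_pow_four {w : ℝ → E3 → ℝ}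
    (hw : Measurable fun y : ℝ × E3 => ‖w y.1 y.2‖ₑ ^ 4) (c : ℝ) :
    Measurable fun y : ℝ × E3 => ‖w (y.1 - c) y.2‖ₑ ^ 4 := by
  have h : Measurable fun y : ℝ × E3 => (y.1 - c, y.2) := by fun_prop
  simpa only [Function.comp_def] using hw.comp h

lemma lintegral_lintegral_const_mul_add {k l : ℝ × E3 → ℝ≥0∞} (hk : Measurable k)
    (hl : Measurable l) (c : ℝ≥0∞) :
    ∫⁻ t, ∫⁻ x, c * (k (t, x) + l (t, x)) =
      c * ((∫⁻ t, ∫⁻ x, k (t, x)) + (∫⁻ t, ∫⁻ x, l (t, x))) := by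
  have hin : ∀ t, ∫⁻ x, c * (k (t, x) + l (t, x)) =
      c * ((∫⁻ x, k (t, x)) + (∫⁻ x, l (t, x))) := fun t => by
    have hkt : Measurable fun x => k (t, x) := hk.comp measurable_prodMk_left
    have hlt : Measurable fun x => l (t, x) := hl.comp measurable_prodMk_left
    rw [lintegral_const_mul c (by fun_prop), lintegral_add_left hkt]
  have hkm : Measurable fun t => ∫⁻ x, k (t, x) := hk.lintegral_prod_right'
  have hlm : Measurable fun t => ∫⁻ x, l (t, x) := hl.lintegral_prod_right'
  simp only [hin]
  rw [lintegral_const_mul c (by fun_prop), lintegral_add_left hkm]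

lemma lintegral_duh_pow_four_le {u : ℝ → E3 → ℝ} {E A : ℝ} (hu : IsNLW u)
    (hE : ∀ t, energy u t ≤ E) (hA : APriori u A) {s t' : ℝ} (hs : 0 ≤ s) (hst : s ≤ t') :
    ∫⁻ t in Ici t', ∫⁻ x, ‖duh u 0 s t x‖ₑ ^ 4 ≤
      16 * kirchhoffConst * (ENNReal.ofReal A ^ 2 * ENNReal.ofReal E) := by
  obtain ⟨hsm, hsch, heq⟩ := hu
  have hu3 : ContDiff ℝ 3 (uncurry u) := by
    rw [univ_prod_univ, contDiffOn_univ] at hsm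
    exact contDiff_infty.1 hsm 3
  have hsol : ∀ t x, tderiv2 u t x - lap (u t) x + u t x ^ 5 = 0 := fun t x =>
    heq t (mem_univ t) x
  have hc : ∀ τ, Measurable fun y : ℝ × E3 => ‖kirchhoff (u τ) (tderiv u τ) y.1 y.2‖ₑ ^ 4 :=
    fun τ => by
      obtain ⟨h0, h1⟩ := hsch τ (mem_univ τ)
      exact (continuous_kirchhoff h0 h1 (ne_top_of_le_ne_top
        (ENNReal.pow_ne_top ENNReal.ofReal_ne_top)
          (lintegral_inv_fourier_sq_le h1 (hA τ).2.1))).measurable.enorm.pow_const 4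
  have hK : ∀ τ, ∫⁻ t, ∫⁻ x, ‖kirchhoff (u τ) (tderiv u τ) (t - τ) x‖ₑ ^ 4 ≤
      kirchhoffConst * (ENNReal.ofReal A ^ 2 * ENNReal.ofReal E) := fun τ => by
    obtain ⟨h0, h1⟩ := hsch τ (mem_univ τ)
    exact (lintegral_enorm_shift_pow_four (hc τ) τ).trans_le
      (lintegral_kirchhoff_le h0 h1 (hE τ) (hA τ).1 (hA τ).2.1)
  have hms : ∀ τ, Measurable fun y : ℝ × E3 =>
      ‖kirchhoff (u τ) (tderiv u τ) (y.1 - τ) y.2‖ₑ ^ 4 := fun τ =>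
    measurable_enorm_shift_pow_four (hc τ) τ
  have hpt : ∀ t, s < t → ∀ x, ‖duh u 0 s t x‖ₑ ^ 4 ≤
      8 * (‖kirchhoff (u 0) (tderiv u 0) (t - 0) x‖ₑ ^ 4 +
        ‖kirchhoff (u s) (tderiv u s) (t - s) x‖ₑ ^ 4) := fun t ht x => by
    refine le_trans ?_ (add_pow_four_le _ _)
    gcongr
    refine le_trans ?_ enorm_sub_le
    rw [← duh_eq_kirchhoff hu3 hsol hs ht x, enorm_mul]
    refine le_mul_of_one_le_left' ?_
    rw [← ofReal_norm, ← ENNReal.ofReal_one, norm_eq_abs, abs_of_pos (by positivity)]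
    exact ENNReal.ofReal_le_ofReal (by linarith [pi_gt_three])
  calc _ = ∫⁻ t in Ioi t', ∫⁻ x, ‖duh u 0 s t x‖ₑ ^ 4 :=
        setLIntegral_congr Ioi_ae_eq_Ici.symm
    _ ≤ ∫⁻ t in Ioi t', ∫⁻ x, 8 * (‖kirchhoff (u 0) (tderiv u 0) (t - 0) x‖ₑ ^ 4 +
        ‖kirchhoff (u s) (tderiv u s) (t - s) x‖ₑ ^ 4) :=
        setLIntegral_mono' measurableSet_Ioi fun t ht =>
          lintegral_mono fun x => hpt t (hst.trans_lt ht) x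
    _ ≤ ∫⁻ t, ∫⁻ x, 8 * (‖kirchhoff (u 0) (tderiv u 0) (t - 0) x‖ₑ ^ 4 +
        ‖kirchhoff (u s) (tderiv u s) (t - s) x‖ₑ ^ 4) := setLIntegral_le_lintegral _ _
    _ = 8 * ((∫⁻ t, ∫⁻ x, ‖kirchhoff (u 0) (tderiv u 0) (t - 0) x‖ₑ ^ 4) +
        (∫⁻ t, ∫⁻ x, ‖kirchhoff (u s) (tderiv u s) (t - s) x‖ₑ ^ 4)) :=
        lintegral_lintegral_const_mul_add (hms 0) (hms s) 8
    _ ≤ 8 * (kirchhoffConst * (ENNReal.ofReal A ^ 2 * ENNReal.ofReal E) +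
        kirchhoffConst * (ENNReal.ofReal A ^ 2 * ENNReal.ofReal E)) :=
        mul_le_mul_right (add_le_add (hK 0) (hK s)) _
    _ = _ := by ring

lemma mixNorm_four_eq (I : Set ℝ) (v : ℝ → E3 → ℝ) :
    mixNorm 4 4 I v = (∫⁻ t in I, ∫⁻ x, ‖v t x‖ₑ ^ 4) ^ ((1 : ℝ) / 4) := by
  rw [mixNorm]
  congr 1
  refine lintegral_congr fun t => ?_
  rw [xNorm, ← ENNReal.rpow_mul]
  norm_num
  rfl

/-- `‖∫_0^{s} S(t-τ)(0,u⁵) dτ‖_{L⁴_{t,x}([t',∞)×ℝ³)} ≤ C E^{1/4} A^{1/2}`. -/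
theorem stmt11 :
    ∃ C : ℝ, 0 < C ∧ ∀ (E A : ℝ) (u : ℝ → E3 → ℝ),
      IsNLW u → (∀ t : ℝ, energy u t ≤ E) → APriori u A →
      ∀ s t' : ℝ, 0 ≤ s → s ≤ t' →
        mixNorm 4 4 (Ici t') (fun t x => duh u 0 s t x) ≤
          ENNReal.ofReal (C * E ^ ((1:ℝ)/4) * A ^ ((1:ℝ)/2)) := by
  set K : ℝ≥0∞ := (16 * kirchhoffConst) ^ ((1 : ℝ) / 4) with hK
  have hKt : K ≠ ∞ := ENNReal.rpow_ne_top_of_nonneg (by norm_num)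
    (ENNReal.mul_ne_top (by norm_num) kirchhoffConst_ne_top)
  refine ⟨K.toReal + 1, by positivity, fun E A u hu hE hA s t' hs hst => ?_⟩
  have hE0 : 0 ≤ E := by
    obtain ⟨h0, h1⟩ := hu.2.1 0 (mem_univ 0)
    have h2 := (energy_bounds h0 h1 (hE 0)).1
    have h3 : 0 ≤ ∫ x, tderiv u 0 x ^ 2 := integral_nonneg fun x => by positivity
    linarith
  rw [mixNorm_four_eq]
  have hbd : (∫⁻ t in Ici t', ∫⁻ x, ‖duh u 0 s t x‖ₑ ^ 4) ^ ((1 : ℝ) / 4) ≤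
      K * (ENNReal.ofReal A ^ ((1 : ℝ) / 2) * ENNReal.ofReal E ^ ((1 : ℝ) / 4)) := by
    refine (ENNReal.rpow_le_rpow (lintegral_duh_pow_four_le hu hE hA hs hst)
      (by norm_num)).trans_eq ?_
    rw [ENNReal.mul_rpow_of_nonneg (16 * kirchhoffConst) _ (by norm_num),
      ENNReal.mul_rpow_of_nonneg (ENNReal.ofReal A ^ 2) _ (by norm_num),
      ← ENNReal.rpow_ofNat (ENNReal.ofReal A), ← ENNReal.rpow_mul, hK]
    norm_num
  refine hbd.trans ?_
  rcases lt_or_ge A 0 with hA0 | hA0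
  · rw [ENNReal.ofReal_of_nonpos hA0.le, ENNReal.zero_rpow_of_pos (by norm_num)]
    simp
  · rw [ENNReal.ofReal_mul (by positivity), ENNReal.ofReal_mul (by positivity),
      ← ENNReal.ofReal_rpow_of_nonneg hE0 (by norm_num),
      ← ENNReal.ofReal_rpow_of_nonneg hA0 (by norm_num)]
    have hKle : K ≤ ENNReal.ofReal (K.toReal + 1) := by
      rw [← ENNReal.ofReal_toReal hKt]
      exact ENNReal.ofReal_le_ofReal (by simp)
    calc _ ≤ ENNReal.ofReal (K.toReal + 1) *
          (ENNReal.ofReal A ^ ((1 : ℝ) / 2) * ENNReal.ofReal E ^ ((1 : ℝ) / 4)) := by gcongr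
      _ = _ := by ring

end
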